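/- arXiv:math/9910041 — 2 statements merged into one kernel-verified Lean document; each statement's English description precedes it below -/
import Mathlib

section
/- Let d = 2, ε = −1 (plasma case). Let f be a C¹ solution of the two-dimensional Vlasov–Poisson system, compactly supported in (x,v) locally uniformly in t, with total mass M > 0, and for each t ≥ 0 let r(t) be the minimal radius of closed balls of ℝ² containing the support of ρ(t,·). Let R solve R̈ = 1/R, R(0) = 1, Ṙ(0) = 0. Then there exist a constant C > 0 and a time T ≥ 0 such that r(t) ≥ C · R(t) for all t ≥ T. -/
open MeasureTheory Set Real Filter
open scoped ENNReal Topology BigOperators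

noncomputable section

/-- The plane. -/
local notation "𝔼" => EuclideanSpace ℝ (Fin 2)

theorem locallyIntegrable_log_norm : LocallyIntegrable (fun z : 𝔼 => Real.log ‖z‖) := by
  have hball : ∀ r : ℝ, IntegrableOn (fun z : 𝔼 => Real.log ‖z‖) (Metric.ball 0 r) := by
    intro r
    rw [integrableOn_fun_norm_addHaar volume (f := Real.log)]
    have hc : Continuous fun y : ℝ => y ^ (Module.finrank ℝ 𝔼 - 1) • Real.log y := by
      simpa using Real.continuous_mul_log
    exact (hc.integrableOn_Icc (a := 0) (b := r)).mono_set Ioo_subset_Icc_self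
  intro z
  exact ⟨Metric.ball 0 (‖z‖ + 1), Metric.isOpen_ball.mem_nhds (by simp), hball _⟩

/-- The logarithmic kernel regularised at the origin. -/
def regLog (η : ℝ) (z : 𝔼) : ℝ := 1 / 2 * Real.log (‖z‖ ^ 2 + η)

theorem hasFDerivAt_regLog {η : ℝ} (hη : 0 < η) (z : 𝔼) :
    HasFDerivAt (regLog η) ((‖z‖ ^ 2 + η)⁻¹ • innerSL ℝ z) z := by
  have h1 : HasFDerivAt (fun z : 𝔼 => ‖z‖ ^ 2 + η) (2 • innerSL ℝ z) z :=
    (hasStrictFDerivAt_norm_sq z).hasFDerivAt.add_const η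
  have h2 := (h1.log (by positivity)).const_mul (1 / 2)
  refine h2.congr_fderiv ?_
  ext w
  simp
  ring

theorem continuous_regLog {η : ℝ} (hη : 0 < η) : Continuous (regLog η) :=
  continuous_iff_continuousAt.2 fun z => (hasFDerivAt_regLog hη z).continuousAt

theorem abs_regLog_le {η : ℝ} (hη : 0 < η) (hη1 : η ≤ 1) {z : 𝔼} (hz : z ≠ 0) :
    |regLog η z| ≤ |Real.log ‖z‖| + regLog 1 z := by
  have hz' : 0 < ‖z‖ := norm_pos_iff.2 hz
  have h1 : Real.log ‖z‖ = 1 / 2 * Real.log (‖z‖ ^ 2) := by rw [Real.log_pow]; push_cast; ring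
  have h2 : Real.log ‖z‖ ≤ regLog η z := by
    rw [h1, regLog]
    gcongr
    linarith
  have h3 : regLog η z ≤ regLog 1 z := by
    unfold regLog
    gcongr
  have h4 : 0 ≤ regLog 1 z := by
    unfold regLog
    have : 0 ≤ Real.log (‖z‖ ^ 2 + 1) := Real.log_nonneg (by nlinarith [sq_nonneg ‖z‖])
    positivity
  rw [abs_le]
  constructor
  · linarith [neg_abs_le (Real.log ‖z‖)]
  · linarith [abs_nonneg (Real.log ‖z‖)]

theorem tendsto_regLog {z : 𝔼} (hz : z ≠ 0) {η : ℕ → ℝ} (hη : Tendsto η atTop (𝓝 0)) :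
    Tendsto (fun n => regLog (η n) z) atTop (𝓝 (Real.log ‖z‖)) := by
  have hz' : 0 < ‖z‖ := norm_pos_iff.2 hz
  have h1 : Real.log ‖z‖ = 1 / 2 * Real.log (‖z‖ ^ 2 + 0) := by
    rw [add_zero, Real.log_pow]; push_cast; ring
  rw [h1]
  have h2 : Tendsto (fun n => ‖z‖ ^ 2 + η n) atTop (𝓝 (‖z‖ ^ 2 + 0)) := hη.const_add _
  exact (h2.log (by positivity)).const_mul _

theorem ae_fst_ne_snd : ∀ᵐ p : 𝔼 × 𝔼, p.1 - p.2 ≠ 0 := by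
  have : MeasurableSet {p : 𝔼 × 𝔼 | p.1 - p.2 ≠ 0} :=
    (isOpen_ne_fun (by fun_prop) (by fun_prop)).measurableSet
  rw [Measure.volume_eq_prod, Measure.ae_prod_iff_ae_ae this]
  refine Eventually.of_forall fun x => ?_
  have h : ∀ᵐ y : 𝔼, y ≠ x := by simp [ae_iff]
  filter_upwards [h] with y hy
  exact sub_ne_zero.2 (Ne.symm hy)

/-- A locally integrable function of `x - y` times a continuous compactly supported function of
`(x, y)` is integrable. -/
theorem integrable_sub_mul {k : 𝔼 → ℝ} (hk : LocallyIntegrable k) {h : 𝔼 × 𝔼 → ℝ}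
    (hh : Continuous h) (hc : HasCompactSupport h) :
    Integrable (fun p : 𝔼 × 𝔼 => k (p.1 - p.2) * h p) := by
  obtain ⟨B, hB⟩ := hc.isCompact.isBounded.subset_closedBall 0
  have hsupp : ∀ p : 𝔼 × 𝔼, h p ≠ 0 → ‖p.1‖ ≤ B ∧ ‖p.2‖ ≤ B := by
    intro p hp
    have := hB (subset_tsupport _ hp)
    rw [mem_closedBall_zero_iff, Prod.norm_def] at this
    exact max_le_iff.1 this
  obtain ⟨H, hH⟩ := hc.exists_bound_of_continuous hh
  have hk1 : Integrable ((Metric.closedBall (0 : 𝔼) (2 * B)).indicator k) :=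
    (hk.integrableOn_isCompact (isCompact_closedBall 0 (2 * B))).integrable_indicator
      Metric.isClosed_closedBall.measurableSet
  have h1 : Integrable ((Metric.closedBall (0 : 𝔼) B).indicator fun _ => (1 : ℝ)) :=
    ((integrableOn_const_iff).2 (Or.inr measure_closedBall_lt_top)).integrable_indicator
      Metric.isClosed_closedBall.measurableSet
  have h2 := h1.convolution_integrand (ContinuousLinearMap.mul ℝ ℝ) hk1
  have h3 := h2.bdd_mul (c := H) (f := h) hh.aestronglyMeasurable (Eventually.of_forall hH)
  refine h3.congr (Eventually.of_forall fun p => ?_)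
  by_cases hp : h p = 0
  · simp [hp]
  · obtain ⟨ha, hb⟩ := hsupp p hp
    have hs : ‖p.1 - p.2‖ ≤ 2 * B := (norm_sub_le _ _).trans (by linarith)
    have hb' : p.2 ∈ Metric.closedBall (0 : 𝔼) B := mem_closedBall_zero_iff.2 hb
    have hs' : p.1 - p.2 ∈ Metric.closedBall (0 : 𝔼) (2 * B) := mem_closedBall_zero_iff.2 hs
    simp only [ContinuousLinearMap.mul_apply', indicator_of_mem hb', indicator_of_mem hs', one_mul]
    exact mul_comm _ _

theorem integral_regLog_mul_fderiv {ρ : 𝔼 → ℝ} (hρ : ContDiff ℝ 1 ρ) (hc : HasCompactSupport ρ)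
    {η : ℝ} (hη : 0 < η) (x w : 𝔼) :
    ∫ y, regLog η (x - y) * fderiv ℝ ρ y w =
      ∫ y, (‖x - y‖ ^ 2 + η)⁻¹ * inner ℝ (x - y) w * ρ y := by
  have hd : ∀ y, HasFDerivAt (fun y => regLog η (x - y))
      (((‖x - y‖ ^ 2 + η)⁻¹ • innerSL ℝ (x - y)).comp (-ContinuousLinearMap.id ℝ 𝔼)) y :=
    fun y => (hasFDerivAt_regLog hη (x - y)).comp y ((hasFDerivAt_id y).const_sub x)
  have hd' : ∀ y, fderiv ℝ (fun y => regLog η (x - y)) y w =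
      -((‖x - y‖ ^ 2 + η)⁻¹ * inner ℝ (x - y) w) := by
    intro y
    rw [(hd y).fderiv]
    simp [-map_sub]
  have hne : ∀ y, ‖x - y‖ ^ 2 + η ≠ 0 := fun y => by positivity
  have hcl : Continuous fun y => regLog η (x - y) := (continuous_regLog hη).comp (by fun_prop)
  have hcf : Continuous fun y => fderiv ℝ ρ y w :=
    (hρ.continuous_fderiv one_ne_zero).clm_apply continuous_const
  have hcK : Continuous fun y => -((‖x - y‖ ^ 2 + η)⁻¹ * inner ℝ (x - y) w) :=
    ((Continuous.inv₀ (by fun_prop) hne).mul (by fun_prop)).neg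
  rw [integral_mul_fderiv_eq_neg_fderiv_mul_of_integrable]
  · rw [← integral_neg]
    congr 1 with y
    rw [hd']
    ring
  · simp_rw [hd']
    exact (hcK.mul hρ.continuous).integrable_of_hasCompactSupport hc.mul_left
  · exact (hcl.mul hcf).integrable_of_hasCompactSupport (hc.fderiv_apply ℝ w).mul_left
  · exact (hcl.mul hρ.continuous).integrable_of_hasCompactSupport hc.mul_left
  · exact fun y _ => (hd y).differentiableAt
  · exact fun y _ => (hρ.differentiable one_ne_zero) y

theorem hasCompactSupport_fst_mul_snd {g h : 𝔼 → ℝ} (hg : HasCompactSupport g)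
    (hh : HasCompactSupport h) : HasCompactSupport fun p : 𝔼 × 𝔼 => g p.1 * h p.2 :=
  HasCompactSupport.intro (hg.isCompact.prod hh.isCompact) fun p hp => by
    by_cases h1 : p.1 ∈ tsupport g
    · rw [image_eq_zero_of_notMem_tsupport (fun h2 => hp ⟨h1, h2⟩), mul_zero]
    · rw [image_eq_zero_of_notMem_tsupport h1, zero_mul]

theorem hasCompactSupport_mul_fderiv {ρ : 𝔼 → ℝ} (hc : HasCompactSupport ρ) (s : ℝ) (a : 𝔼) :
    HasCompactSupport fun p : 𝔼 × 𝔼 => ρ p.1 * fderiv ℝ ρ p.2 (s • p.1 + a) := by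
  refine (hasCompactSupport_fst_mul_snd hc (hc.fderiv ℝ).norm).mono' fun p hp =>
    subset_tsupport _ ?_
  rw [Function.mem_support] at hp ⊢
  refine mul_ne_zero (left_ne_zero_of_mul hp) (norm_ne_zero_iff.2 fun h => hp ?_)
  simp [h]

theorem integral_prod_regLog {ρ : 𝔼 → ℝ} (hρ : ContDiff ℝ 1 ρ) (hc : HasCompactSupport ρ)
    {η : ℝ} (hη : 0 < η) (s : ℝ) (a : 𝔼) :
    ∫ p : 𝔼 × 𝔼, regLog η (p.1 - p.2) * (ρ p.1 * fderiv ℝ ρ p.2 (s • p.1 + a)) =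
      s / 2 * ∫ p : 𝔼 × 𝔼, ‖p.1 - p.2‖ ^ 2 / (‖p.1 - p.2‖ ^ 2 + η) * (ρ p.1 * ρ p.2) := by
  have hcf : Continuous fun p : 𝔼 × 𝔼 => fderiv ℝ ρ p.2 (s • p.1 + a) :=
    ((hρ.continuous_fderiv one_ne_zero).comp continuous_snd).clm_apply (by fun_prop)
  have hρc := hρ.continuous
  have hcs := hasCompactSupport_mul_fderiv hc s a
  have hne : ∀ p : 𝔼 × 𝔼, ‖p.1 - p.2‖ ^ 2 + η ≠ 0 := fun p => by positivity
  have hci : Continuous fun p : 𝔼 × 𝔼 => (‖p.1 - p.2‖ ^ 2 + η)⁻¹ :=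
    Continuous.inv₀ (by fun_prop) hne
  have hρρ := hasCompactSupport_fst_mul_snd hc hc
  have hI1 : Integrable fun p : 𝔼 × 𝔼 =>
      (‖p.1 - p.2‖ ^ 2 + η)⁻¹ * inner ℝ (p.1 - p.2) (s • p.1 + a) * (ρ p.1 * ρ p.2) :=
    Continuous.integrable_of_hasCompactSupport (by fun_prop) hρρ.mul_left
  have hI2 : Integrable fun p : 𝔼 × 𝔼 =>
      (‖p.1 - p.2‖ ^ 2 + η)⁻¹ * inner ℝ (p.2 - p.1) (s • p.2 + a) * (ρ p.1 * ρ p.2) :=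
    Continuous.integrable_of_hasCompactSupport (by fun_prop) hρρ.mul_left
  have hI0 : Integrable fun p : 𝔼 × 𝔼 =>
      regLog η (p.1 - p.2) * (ρ p.1 * fderiv ℝ ρ p.2 (s • p.1 + a)) :=
    (((continuous_regLog hη).comp (by fun_prop)).mul
      (by fun_prop)).integrable_of_hasCompactSupport hcs.mul_left
  have h1 : ∫ p : 𝔼 × 𝔼, regLog η (p.1 - p.2) * (ρ p.1 * fderiv ℝ ρ p.2 (s • p.1 + a)) =
      ∫ p : 𝔼 × 𝔼,
        (‖p.1 - p.2‖ ^ 2 + η)⁻¹ * inner ℝ (p.1 - p.2) (s • p.1 + a) * (ρ p.1 * ρ p.2) := by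
    rw [Measure.volume_eq_prod, integral_prod _ hI0, integral_prod _ hI1]
    congr 1 with x
    have := congrArg (ρ x * ·) (integral_regLog_mul_fderiv hρ hc hη x (s • x + a))
    simp only [← integral_const_mul] at this
    refine (Eq.trans (integral_congr_ae (Eventually.of_forall fun y => ?_)) this).trans
      (integral_congr_ae (Eventually.of_forall fun y => ?_)) <;> (dsimp only; ring)
  have h2 : ∫ p : 𝔼 × 𝔼,
        (‖p.1 - p.2‖ ^ 2 + η)⁻¹ * inner ℝ (p.1 - p.2) (s • p.1 + a) * (ρ p.1 * ρ p.2) =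
      ∫ p : 𝔼 × 𝔼,
        (‖p.1 - p.2‖ ^ 2 + η)⁻¹ * inner ℝ (p.2 - p.1) (s • p.2 + a) * (ρ p.1 * ρ p.2) := by
    rw [Measure.volume_eq_prod, ← integral_prod_swap]
    congr 1 with p
    simp only [Prod.fst_swap, Prod.snd_swap]
    rw [norm_sub_rev, mul_comm (ρ p.2)]
  have h3 := integral_add hI1 hI2
  rw [← h2, ← h1, ← two_mul] at h3
  have h4 : ∫ p : 𝔼 × 𝔼, ((‖p.1 - p.2‖ ^ 2 + η)⁻¹ * inner ℝ (p.1 - p.2) (s • p.1 + a)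
        * (ρ p.1 * ρ p.2) +
      (‖p.1 - p.2‖ ^ 2 + η)⁻¹ * inner ℝ (p.2 - p.1) (s • p.2 + a) * (ρ p.1 * ρ p.2)) =
      s * ∫ p : 𝔼 × 𝔼, ‖p.1 - p.2‖ ^ 2 / (‖p.1 - p.2‖ ^ 2 + η) * (ρ p.1 * ρ p.2) := by
    rw [← integral_const_mul]
    congr 1 with p
    have : inner ℝ (p.1 - p.2) (s • p.1 + a) + inner ℝ (p.2 - p.1) (s • p.2 + a) =
        s * ‖p.1 - p.2‖ ^ 2 := by
      rw [← neg_sub p.1 p.2, inner_neg_left, ← sub_eq_add_neg, ← inner_sub_right,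
        add_sub_add_right_eq_sub, ← smul_sub, inner_smul_right, real_inner_self_eq_norm_sq]
    rw [div_eq_mul_inv]
    linear_combination (‖p.1 - p.2‖ ^ 2 + η)⁻¹ * (ρ p.1 * ρ p.2) * this
  linarith

theorem integral_prod_log {ρ : 𝔼 → ℝ} (hρ : ContDiff ℝ 1 ρ) (hc : HasCompactSupport ρ)
    (s : ℝ) (a : 𝔼) :
    Integrable (fun p : 𝔼 × 𝔼 =>
      Real.log ‖p.1 - p.2‖ * (ρ p.1 * fderiv ℝ ρ p.2 (s • p.1 + a))) ∧
    ∫ p : 𝔼 × 𝔼, Real.log ‖p.1 - p.2‖ * (ρ p.1 * fderiv ℝ ρ p.2 (s • p.1 + a)) =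
      s / 2 * (∫ x, ρ x) ^ 2 := by
  have hcf : Continuous fun p : 𝔼 × 𝔼 => fderiv ℝ ρ p.2 (s • p.1 + a) :=
    ((hρ.continuous_fderiv one_ne_zero).comp continuous_snd).clm_apply (by fun_prop)
  have hρc := hρ.continuous
  have hch : Continuous fun p : 𝔼 × 𝔼 => ρ p.1 * fderiv ℝ ρ p.2 (s • p.1 + a) := by fun_prop
  have hcs := hasCompactSupport_mul_fderiv hc s a
  have hρρ := hasCompactSupport_fst_mul_snd hc hc
  have hlog := integrable_sub_mul locallyIntegrable_log_norm hch hcs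
  refine ⟨hlog, ?_⟩
  set η : ℕ → ℝ := fun n => 1 / ((n : ℝ) + 1) with hη
  have hη0 : Tendsto η atTop (𝓝 0) := tendsto_one_div_add_atTop_nhds_zero_nat
  have hηpos : ∀ n, 0 < η n := fun n => by simp only [hη]; positivity
  have hη1 : ∀ n, η n ≤ 1 := fun n => by
    simp only [hη]
    rw [div_le_one (by positivity)]
    linarith [(Nat.cast_nonneg n : (0 : ℝ) ≤ n)]
  have hL : Tendsto (fun n => ∫ p : 𝔼 × 𝔼,
        regLog (η n) (p.1 - p.2) * (ρ p.1 * fderiv ℝ ρ p.2 (s • p.1 + a))) atTop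
      (𝓝 (∫ p : 𝔼 × 𝔼, Real.log ‖p.1 - p.2‖ * (ρ p.1 * fderiv ℝ ρ p.2 (s • p.1 + a)))) := by
    have hb := integrable_sub_mul (continuous_regLog one_pos).locallyIntegrable hch hcs
    refine tendsto_integral_of_dominated_convergence _ (fun n => ?_) (hlog.norm.add hb.norm)
      (fun n => ?_) ?_
    · exact (((continuous_regLog (hηpos n)).comp (by fun_prop)).mul hch).aestronglyMeasurable
    · filter_upwards [ae_fst_ne_snd] with p hp
      have h0 : 0 ≤ |regLog 1 (p.1 - p.2)| := abs_nonneg _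
      simp only [Pi.add_apply, norm_mul _ (ρ p.1 * _), ← add_mul]
      gcongr
      exact (abs_regLog_le (hηpos n) (hη1 n) hp).trans (by
        simp only [Real.norm_eq_abs]; gcongr; exact le_abs_self _)
    · filter_upwards [ae_fst_ne_snd] with p hp
      exact (tendsto_regLog hp hη0).mul_const _
  have hR : Tendsto (fun n => s / 2 * ∫ p : 𝔼 × 𝔼,
        ‖p.1 - p.2‖ ^ 2 / (‖p.1 - p.2‖ ^ 2 + η n) * (ρ p.1 * ρ p.2)) atTop
      (𝓝 (s / 2 * ∫ p : 𝔼 × 𝔼, ρ p.1 * ρ p.2)) := by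
    refine Tendsto.const_mul _ ?_
    have hρρi : Integrable fun p : 𝔼 × 𝔼 => ρ p.1 * ρ p.2 :=
      Continuous.integrable_of_hasCompactSupport (by fun_prop) hρρ
    refine tendsto_integral_of_dominated_convergence _ (fun n => ?_) hρρi.norm (fun n => ?_) ?_
    · refine Continuous.aestronglyMeasurable (Continuous.mul (Continuous.div (by fun_prop)
        (by fun_prop) fun p => ?_) (by fun_prop))
      have := hηpos n
      positivity
    · refine Eventually.of_forall fun p => ?_
      have := hηpos n
      rw [norm_mul]
      refine mul_le_of_le_one_left (norm_nonneg _) ?_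
      rw [Real.norm_of_nonneg (by positivity)]
      exact div_le_one_of_le₀ (by linarith) (by positivity)
    · filter_upwards [ae_fst_ne_snd] with p hp
      have hp' : 0 < ‖p.1 - p.2‖ := norm_pos_iff.2 hp
      have h1 : Tendsto (fun n => ‖p.1 - p.2‖ ^ 2 / (‖p.1 - p.2‖ ^ 2 + η n)) atTop
          (𝓝 (‖p.1 - p.2‖ ^ 2 / (‖p.1 - p.2‖ ^ 2 + 0))) :=
        tendsto_const_nhds.div (hη0.const_add _) (by positivity)
      rw [add_zero, div_self (by positivity)] at h1
      simpa using h1.mul_const (ρ p.1 * ρ p.2)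
  simp_rw [fun n => integral_prod_regLog hρ hc (hηpos n) s a] at hL
  rw [tendsto_nhds_unique hL hR, Measure.volume_eq_prod, integral_prod_mul, sq]

/-- For a compactly supported `C¹` density the logarithmic potential is `C¹`, and the moments of
its gradient against affine vector fields are given by the symmetrised kernel. -/
theorem logPotential_spec {ρ : 𝔼 → ℝ} (hρ : ContDiff ℝ 1 ρ) (hc : HasCompactSupport ρ)
    {U : 𝔼 → ℝ} (hU : ∀ x, U x = -(1 / (2 * π)) * ∫ y, Real.log ‖x - y‖ * ρ y) :
    ContDiff ℝ 1 U ∧ ∀ (s : ℝ) (a : 𝔼),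
      ∫ x, ρ x * fderiv ℝ U x (s • x + a) = -(s / (4 * π)) * (∫ x, ρ x) ^ 2 := by
  have hU' : U = fun x => -(1 / (2 * π)) *
      convolution (fun z : 𝔼 => Real.log ‖z‖) ρ (ContinuousLinearMap.mul ℝ ℝ) volume x := by
    ext x
    rw [hU, convolution_mul_swap]
  have hC1 : ContDiff ℝ 1 U := by
    rw [hU']
    exact contDiff_const.mul
      (hc.contDiff_convolution_right (n := 1) _ locallyIntegrable_log_norm hρ)
  refine ⟨hC1, fun s a => ?_⟩
  have hd : ∀ x w, fderiv ℝ U x w = -(1 / (2 * π)) * ∫ y, Real.log ‖x - y‖ * fderiv ℝ ρ y w := by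
    intro x w
    have h1 := (hc.hasFDerivAt_convolution_right (ContinuousLinearMap.mul ℝ ℝ)
      locallyIntegrable_log_norm hρ x).const_mul (-(1 / (2 * π)))
    rw [← hU'] at h1
    rw [h1.fderiv, smul_apply, convolution_precompR_apply _
      locallyIntegrable_log_norm (hc.fderiv ℝ) (hρ.continuous_fderiv one_ne_zero),
      convolution_mul_swap, smul_eq_mul]
  have h := integral_prod_log hρ hc s a
  rw [Measure.volume_eq_prod, integral_prod _ h.1] at h
  have e : ∀ x, ρ x * fderiv ℝ U x (s • x + a) = -(1 / (2 * π)) *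
      ∫ y, Real.log ‖x - y‖ * (ρ x * fderiv ℝ ρ y (s • x + a)) := by
    intro x
    rw [hd, mul_left_comm, ← integral_const_mul]
    congr 2 with y
    ring
  simp_rw [e]
  rw [integral_const_mul, h.2]
  field_simp
  ring

theorem contDiff_integral_snd {F : 𝔼 × 𝔼 → ℝ} (hF : ContDiff ℝ 1 F) (hc : HasCompactSupport F) :
    ContDiff ℝ 1 fun x => ∫ v, F (x, v) := by
  have h := contDiffOn_convolution_right_with_param_comp (n := 1) (μ := (volume : Measure 𝔼))
    (ContinuousLinearMap.mul ℝ ℝ) (s := univ) (v := fun _ : 𝔼 => (0 : 𝔼)) contDiffOn_const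
    (f := fun _ : 𝔼 => (1 : ℝ)) (g := fun x v => F (x, -v))
    (k := (fun p : 𝔼 × 𝔼 => -p.2) '' tsupport F) isOpen_univ
    (hc.isCompact.image (by fun_prop)) ?_ (locallyIntegrable_const 1) ?_
  · rw [contDiffOn_univ] at h
    simpa [convolution_def] using h
  · intro x v _ hv
    refine image_eq_zero_of_notMem_tsupport fun h => hv ⟨_, h, by simp⟩
  · exact (hF.comp (contDiff_fst.prodMk contDiff_snd.neg)).contDiffOn

theorem hasCompactSupport_integral_snd {F : 𝔼 × 𝔼 → ℝ} (hc : HasCompactSupport F) :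
    HasCompactSupport fun x => ∫ v, F (x, v) := by
  refine HasCompactSupport.intro (hc.isCompact.image continuous_fst) fun x hx => ?_
  have : ∀ v, F (x, v) = 0 := fun v =>
    image_eq_zero_of_notMem_tsupport fun h => hx ⟨_, h, rfl⟩
  simp [this]

/-- Integration by parts in a direction along which the coefficient `c` is constant. -/
theorem integral_mul_fderiv_of_const_along {φ F c : 𝔼 × 𝔼 → ℝ} (hφ : ContDiff ℝ 1 φ)
    (hF : ContDiff ℝ 1 F) (hc : HasCompactSupport F) (hcc : Continuous c) {w : 𝔼 × 𝔼}
    (hw : ∀ p (τ : ℝ), c (p + τ • w) = c p) :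
    ∫ p, φ p * c p * fderiv ℝ F p w = -∫ p, fderiv ℝ φ p w * c p * F p := by
  have : (volume : Measure (𝔼 × 𝔼)).IsAddHaarMeasure :=
    Measure.prod.instIsAddHaarMeasure volume volume
  have hφ' : Continuous fun p => fderiv ℝ φ p w :=
    (hφ.continuous_fderiv one_ne_zero).clm_apply continuous_const
  have hF' : Continuous fun p => fderiv ℝ F p w :=
    (hF.continuous_fderiv one_ne_zero).clm_apply continuous_const
  have hφc := hφ.continuous
  have hFc := hF.continuous
  refine integral_bilinear_hasLineDerivAt_right_eq_neg_left_of_integrable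
    (B := ContinuousLinearMap.mul ℝ ℝ) (f := fun p => φ p * c p) (g := F) (v := w) ?_ ?_ ?_
    (fun p _ => ?_) (fun p _ => ?_)
  · exact Continuous.integrable_of_hasCompactSupport
      (by simp only [ContinuousLinearMap.mul_apply']; fun_prop) hc.mul_left
  · exact Continuous.integrable_of_hasCompactSupport
      (by simp only [ContinuousLinearMap.mul_apply']; fun_prop)
      (hc.fderiv_apply ℝ w).mul_left
  · exact Continuous.integrable_of_hasCompactSupport
      (by simp only [ContinuousLinearMap.mul_apply']; fun_prop) hc.mul_left
  · have h := ((hφ.differentiable one_ne_zero) p).hasFDerivAt.hasLineDerivAt w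
    unfold HasLineDerivAt at h ⊢
    simp only [hw]
    exact h.mul_const _
  · exact ((hF.differentiable one_ne_zero) p).hasFDerivAt.hasLineDerivAt w

/-- The phase space vector field `(x, v) ↦ (v, E x)` is divergence free. -/
theorem integral_mul_fderiv_transport {φ F : 𝔼 × 𝔼 → ℝ} (hφ : ContDiff ℝ 1 φ)
    (hF : ContDiff ℝ 1 F) (hc : HasCompactSupport F) {E : 𝔼 → 𝔼} (hE : Continuous E) :
    ∫ p, φ p * fderiv ℝ F p (p.2, E p.1) = -∫ p, fderiv ℝ φ p (p.2, E p.1) * F p := by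
  let e : Fin 2 → 𝔼 := fun i => EuclideanSpace.single i 1
  have hsum : ∀ x : 𝔼, x = ∑ i, x i • e i := by
    intro x
    ext j
    fin_cases j <;> simp [e]
  have hdec : ∀ (L : 𝔼 × 𝔼 →L[ℝ] ℝ) (p : 𝔼 × 𝔼), L (p.2, E p.1) =
      ∑ i, (p.2 i * L (e i, 0) + E p.1 i * L (0, e i)) := by
    intro L p
    have : (p.2, E p.1) = ∑ i, (p.2 i • ((e i, 0) : 𝔼 × 𝔼) + E p.1 i • ((0, e i) : 𝔼 × 𝔼)) := by
      rw [Finset.sum_add_distrib]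
      ext1
      · simpa [Prod.fst_sum, Prod.snd_sum] using hsum p.2
      · simpa [Prod.fst_sum, Prod.snd_sum] using hsum (E p.1)
    rw [this, map_sum]
    simp only [map_add, map_smul, smul_eq_mul]
  have hcoord1 : ∀ i, Continuous fun p : 𝔼 × 𝔼 => p.2 i := fun i => by fun_prop
  have hcoord2 : ∀ i, Continuous fun p : 𝔼 × 𝔼 => E p.1 i := fun i => by fun_prop
  have key1 : ∀ i, ∫ p, φ p * p.2 i * fderiv ℝ F p (e i, 0) =
      -∫ p, fderiv ℝ φ p (e i, 0) * p.2 i * F p := fun i =>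
    integral_mul_fderiv_of_const_along (c := fun p => p.2 i) hφ hF hc (hcoord1 i) (by simp)
  have key2 : ∀ i, ∫ p, φ p * E p.1 i * fderiv ℝ F p (0, e i) =
      -∫ p, fderiv ℝ φ p (0, e i) * E p.1 i * F p := fun i =>
    integral_mul_fderiv_of_const_along (c := fun p => E p.1 i) hφ hF hc (hcoord2 i) (by simp)
  have hφ' : ∀ w, Continuous fun p => fderiv ℝ φ p w := fun w =>
    (hφ.continuous_fderiv one_ne_zero).clm_apply continuous_const
  have hF' : ∀ w, Continuous fun p => fderiv ℝ F p w := fun w =>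
    (hF.continuous_fderiv one_ne_zero).clm_apply continuous_const
  have int1 : ∀ c : 𝔼 × 𝔼 → ℝ, Continuous c → ∀ w,
      Integrable fun p => φ p * c p * fderiv ℝ F p w := fun c hcc w =>
    ((hφ.continuous.mul hcc).mul (hF' w)).integrable_of_hasCompactSupport
      (hc.fderiv_apply ℝ w).mul_left
  have int2 : ∀ c : 𝔼 × 𝔼 → ℝ, Continuous c → ∀ w,
      Integrable fun p => fderiv ℝ φ p w * c p * F p := fun c hcc w =>
    (((hφ' w).mul hcc).mul hF.continuous).integrable_of_hasCompactSupport hc.mul_left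
  have e1 : ∀ p, φ p * fderiv ℝ F p (p.2, E p.1) = ∑ i, (φ p * p.2 i * fderiv ℝ F p (e i, 0) +
      φ p * E p.1 i * fderiv ℝ F p (0, e i)) := by
    intro p
    rw [hdec, Finset.mul_sum]
    exact Finset.sum_congr rfl fun i _ => by ring
  have e2 : ∀ p, fderiv ℝ φ p (p.2, E p.1) * F p = ∑ i, (fderiv ℝ φ p (e i, 0) * p.2 i * F p +
      fderiv ℝ φ p (0, e i) * E p.1 i * F p) := by
    intro p
    rw [hdec, Finset.sum_mul]
    exact Finset.sum_congr rfl fun i _ => by ring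
  simp_rw [e1, e2]
  rw [integral_finsetSum _ fun i _ => by exact (int1 _ (hcoord1 i) _).add (int1 _ (hcoord2 i) _),
    integral_finsetSum _ fun i _ => by exact (int2 _ (hcoord1 i) _).add (int2 _ (hcoord2 i) _),
    ← Finset.sum_neg_distrib]
  refine Finset.sum_congr rfl fun i _ => ?_
  rw [integral_add (int1 _ (hcoord1 i) _) (int1 _ (hcoord2 i) _),
    integral_add (int2 _ (hcoord1 i) _) (int2 _ (hcoord2 i) _), key1, key2, neg_add]

/-- Evolution of the moments of a solution of the Vlasov equation in a given potential. -/
theorem hasDerivAt_moment {f : ℝ → 𝔼 → 𝔼 → ℝ} {U : ℝ → 𝔼 → ℝ}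
    (hf_C1 : ContDiff ℝ 1 (fun p : ℝ × 𝔼 × 𝔼 => f p.1 p.2.1 p.2.2))
    (hf_supp : ∀ T₀ : ℝ, ∃ K₀ : ℝ, ∀ t ∈ Icc (0 : ℝ) T₀, ∀ x v,
      (K₀ ≤ ‖x‖ ∨ K₀ ≤ ‖v‖) → f t x v = 0)
    (hVlasov : ∀ t : ℝ, 0 ≤ t → ∀ x v,
      deriv (fun s => f s x v) t
        + fderiv ℝ (fun y => f t y v) x v
        - fderiv ℝ (fun w => f t x w) v (gradient (fun y => U t y) x) = 0)
    {t : ℝ} (ht : 0 < t) (hU : ContDiff ℝ 1 (U t)) {φ : 𝔼 × 𝔼 → ℝ} (hφ : ContDiff ℝ 1 φ) :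
    HasDerivAt (fun s => ∫ p : 𝔼 × 𝔼, φ p * f s p.1 p.2)
      (∫ p : 𝔼 × 𝔼, fderiv ℝ φ p (p.2, -gradient (U t) p.1) * f t p.1 p.2) t := by
  obtain ⟨K, hK⟩ := hf_supp (t + 1)
  set Φ : ℝ × 𝔼 × 𝔼 → ℝ := fun p => f p.1 p.2.1 p.2.2 with hΦ
  set B : Set (𝔼 × 𝔼) := Metric.closedBall 0 K ×ˢ Metric.closedBall 0 K with hB
  have hBc : IsCompact B := (isCompact_closedBall _ _).prod (isCompact_closedBall _ _)
  have hzero : ∀ s ∈ Icc (0 : ℝ) (t + 1), ∀ p : 𝔼 × 𝔼, p ∉ B → f s p.1 p.2 = 0 := by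
    intro s hs p hp
    refine hK s hs _ _ ?_
    by_contra! h
    exact hp ⟨by simpa using h.1.le, by simpa using h.2.le⟩
  have hmem : t ∈ Icc (0 : ℝ) (t + 1) := ⟨ht.le, by linarith⟩
  have hFC : ContDiff ℝ 1 fun p : 𝔼 × 𝔼 => f t p.1 p.2 :=
    hf_C1.comp (contDiff_const.prodMk contDiff_id)
  have hFs : HasCompactSupport fun p : 𝔼 × 𝔼 => f t p.1 p.2 :=
    HasCompactSupport.intro hBc (hzero t hmem)
  have hdt : ∀ s (p : 𝔼 × 𝔼), HasDerivAt (fun s => f s p.1 p.2) (fderiv ℝ Φ (s, p) (1, 0)) s := by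
    intro s p
    have h1 : HasFDerivAt Φ (fderiv ℝ Φ (s, p)) (s, p) :=
      ((hf_C1.differentiable one_ne_zero) (s, p)).hasFDerivAt
    exact h1.comp_hasDerivAt s ((hasDerivAt_id s).prodMk (hasDerivAt_const s p))
  have hΦ' : Continuous fun q : ℝ × 𝔼 × 𝔼 => φ q.2 * fderiv ℝ Φ q (1, 0) :=
    (hφ.continuous.comp continuous_snd).mul
      ((hf_C1.continuous_fderiv one_ne_zero).clm_apply continuous_const)
  obtain ⟨C, hC⟩ := (isCompact_Icc.prod hBc).exists_bound_of_continuousOn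
    (s := Icc (0 : ℝ) (t + 1) ×ˢ B) hΦ'.continuousOn
  have hs : Ioo (0 : ℝ) (t + 1) ∈ 𝓝 t := Ioo_mem_nhds ht (by linarith)
  have main := (hasDerivAt_integral_of_dominated_loc_of_deriv_le (μ := (volume : Measure (𝔼 × 𝔼)))
    (F := fun s p => φ p * f s p.1 p.2) (x₀ := t) (s := Ioo (0 : ℝ) (t + 1))
    (F' := fun s p => φ p * fderiv ℝ Φ (s, p) (1, 0)) (bound := B.indicator fun _ => C)
    hs ?_ ?_ ?_ ?_ ?_ ?_).2
  · refine main.congr_deriv ?_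
    have h := integral_mul_fderiv_transport hφ hFC hFs (E := fun x => -gradient (U t) x) ?_
    · rw [← neg_eq_iff_eq_neg] at h
      rw [← h, ← integral_neg]
      congr 1 with p
      have hFd : HasFDerivAt (fun p : 𝔼 × 𝔼 => f t p.1 p.2)
          (fderiv ℝ (fun p : 𝔼 × 𝔼 => f t p.1 p.2) p) (p.1, p.2) :=
        ((hFC.differentiable one_ne_zero) p).hasFDerivAt
      have hx := HasFDerivAt.comp (f := fun y : 𝔼 => (y, p.2)) p.1 hFd
        (hasFDerivAt_prodMk_left p.1 p.2)
      have hv := HasFDerivAt.comp (f := fun w : 𝔼 => (p.1, w)) p.2 hFd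
        (hasFDerivAt_prodMk_right p.1 p.2)
      simp only [Function.comp_def] at hx hv
      have hV := hVlasov t ht.le p.1 p.2
      rw [(hdt t p).deriv, hx.fderiv, hv.fderiv] at hV
      simp only [ContinuousLinearMap.comp_apply, ContinuousLinearMap.inl_apply,
        ContinuousLinearMap.inr_apply] at hV
      have hsplit : ((p.2, -gradient (U t) p.1) : 𝔼 × 𝔼) =
          (p.2, 0) - (0, gradient (U t) p.1) := by simp
      rw [hsplit, map_sub]
      linear_combination φ p * hV
    · have : Continuous fun x => gradient (U t) x :=
        (InnerProductSpace.toDual ℝ 𝔼).symm.continuous.comp (hU.continuous_fderiv one_ne_zero)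
      exact this.neg
  · refine Eventually.of_forall fun s => ?_
    exact (hφ.continuous.mul (hf_C1.continuous.comp
      (continuous_const.prodMk continuous_id))).aestronglyMeasurable
  · exact (hφ.continuous.mul hFC.continuous).integrable_of_hasCompactSupport hFs.mul_left
  · exact (hΦ'.comp (continuous_const.prodMk continuous_id)).aestronglyMeasurable
  · refine Eventually.of_forall fun p s hs => ?_
    by_cases hp : p ∈ B
    · rw [indicator_of_mem hp]
      exact hC (s, p) ⟨Ioo_subset_Icc_self hs, hp⟩
    · have h0 : (fun s => f s p.1 p.2) =ᶠ[𝓝 s] fun _ => 0 := by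
        filter_upwards [Ioo_mem_nhds hs.1 hs.2] with s' hs'
        exact hzero s' (Ioo_subset_Icc_self hs') p hp
      have := (hdt s p).unique ((hasDerivAt_const s (0 : ℝ)).congr_of_eventuallyEq h0)
      simp [this, hp]
  · exact ((integrableOn_const_iff).2 (Or.inr hBc.measure_lt_top)).integrable_indicator
      hBc.measurableSet
  · exact Eventually.of_forall fun p s _ => (hdt s p).const_mul (φ p)

/-- The first integral `Ṙ² = 2 log R` of `R̈ = 1 / R`, `R 0 = 1`, `Ṙ 0 = 0`. -/
theorem deriv_sq_eq_two_mul_log {R : ℝ → ℝ} (hR : ContDiff ℝ 2 R) (hR0 : R 0 = 1)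
    (hR'0 : deriv R 0 = 0) (hRpos : ∀ t : ℝ, 0 ≤ t → 0 < R t)
    (hRode : ∀ t : ℝ, 0 ≤ t → deriv (deriv R) t = (R t)⁻¹) {t : ℝ} (ht : 0 ≤ t) :
    deriv R t ^ 2 = 2 * Real.log (R t) := by
  have h1 : ∀ s, HasDerivAt R (deriv R s) s :=
    fun s => ((hR.differentiable two_ne_zero) s).hasDerivAt
  have h2 : ∀ s, HasDerivAt (deriv R) (deriv (deriv R) s) s := fun s =>
    (((contDiff_succ_iff_deriv (n := 1)).1 hR).2.2.differentiable one_ne_zero s).hasDerivAt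
  have hd : ∀ s, 0 ≤ s → HasDerivAt (fun s => deriv R s ^ 2 - 2 * Real.log (R s)) 0 s := by
    intro s hs
    have hp := hRpos s hs
    refine (((h2 s).pow 2).sub (((h1 s).log hp.ne').const_mul 2)).congr_deriv ?_
    rw [hRode s hs]
    field_simp
    simp
  have := constant_of_has_deriv_right_zero (a := 0) (b := t)
    (fun s hs => (hd s hs.1).continuousAt.continuousWithinAt)
    (fun s hs => (hd s hs.1).hasDerivWithinAt) t (right_mem_Icc.2 ht)
  simp only [hR0, hR'0, Real.log_one] at this
  linarith

theorem monotoneOn_Ici_of_hasDerivAt {g g' : ℝ → ℝ} {a : ℝ}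
    (h : ∀ t, a ≤ t → HasDerivAt g (g' t) t) (h' : ∀ t, a ≤ t → 0 ≤ g' t) :
    MonotoneOn g (Ici a) := by
  refine monotoneOn_of_deriv_nonneg (convex_Ici a)
    (fun t ht => (h t ht).continuousAt.continuousWithinAt)
    (fun t ht => (h t (interior_subset ht)).differentiableAt.differentiableWithinAt)
    fun t ht => ?_
  rw [(h t (interior_subset ht)).deriv]
  exact h' t (interior_subset ht)

/-- A virial inequality `I'' = 2 (K + b)` with `(I' / 2) ^ 2 ≤ I K` forces `√I` to grow at least
like the solution of `R̈ = 1 / R`. -/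
theorem exists_mul_le_sqrt_of_virial {I J K R : ℝ → ℝ} {b : ℝ} (hb : 0 < b)
    (hI : ∀ t, 0 < t → HasDerivAt I (2 * J t) t)
    (hJ : ∀ t, 0 < t → HasDerivAt J (K t + b) t)
    (hK0 : ∀ t, 0 < t → 0 ≤ K t) (hI0 : ∀ t, 0 < t → 0 ≤ I t)
    (hCS : ∀ t, 0 < t → J t ^ 2 ≤ I t * K t)
    (hR : ContDiff ℝ 2 R) (hR0 : R 0 = 1) (hR'0 : deriv R 0 = 0)
    (hRpos : ∀ t : ℝ, 0 ≤ t → 0 < R t)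
    (hRode : ∀ t : ℝ, 0 ≤ t → deriv (deriv R) t = (R t)⁻¹) :
    ∃ C : ℝ, 0 < C ∧ ∃ T : ℝ, 0 ≤ T ∧ ∀ t : ℝ, T ≤ t → C * R t ≤ √(I t) := by
  obtain ⟨T, hT, hJpos⟩ : ∃ T : ℝ, 0 < T ∧ ∀ t, T ≤ t → 0 < J t := by
    have hmono : MonotoneOn (fun t => J t - b * t) (Ici 1) := by
      refine monotoneOn_Ici_of_hasDerivAt (g' := fun t => K t + b - b * 1) (fun t ht => ?_)
        fun t ht => ?_
      · exact (hJ t (by linarith)).sub ((hasDerivAt_id t).const_mul b)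
      · linarith [hK0 t (by linarith)]
    refine ⟨2 + |J 1| / b, by positivity, fun t ht => ?_⟩
    have h0 : 0 ≤ |J 1| / b := by positivity
    have h1 := hmono (mem_Ici.2 le_rfl) (mem_Ici.2 (by linarith : (1 : ℝ) ≤ t)) (by linarith)
    have h2 : b * (2 + |J 1| / b) ≤ b * t := by gcongr
    have h3 : b * (2 + |J 1| / b) = 2 * b + |J 1| := by field_simp
    simp only at h1
    linarith [neg_abs_le (J 1)]
  have hpos : ∀ t, T ≤ t → 0 < I t := by
    intro t ht
    have ht0 : 0 < t := hT.trans_le ht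
    refine (hI0 t ht0).lt_of_ne fun h => ?_
    have := hCS t ht0
    rw [← h, zero_mul] at this
    nlinarith [hJpos t ht]
  have hImono : MonotoneOn I (Ici T) :=
    monotoneOn_Ici_of_hasDerivAt (fun t ht => hI t (hT.trans_le ht))
      fun t ht => by linarith [hJpos t ht]
  have hEmono : MonotoneOn (fun t => J t ^ 2 / I t - b * Real.log (I t)) (Ici T) := by
    refine monotoneOn_Ici_of_hasDerivAt
      (g' := fun t => 2 * J t / I t ^ 2 * (I t * K t - J t ^ 2)) (fun t ht => ?_) fun t ht => ?_
    · have hp := hpos t ht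
      have ht0 := hT.trans_le ht
      refine ((((hJ t ht0).pow 2).div (hI t ht0) hp.ne').sub
        (((hI t ht0).log hp.ne').const_mul b)).congr_deriv ?_
      field_simp
      simp
      ring
    · have hp := hpos t ht
      have := hJpos t ht
      have := hCS t (hT.trans_le ht)
      exact mul_nonneg (by positivity) (by linarith)
  have hIT := hpos T le_rfl
  have hJT := hJpos T le_rfl
  obtain ⟨C, ⟨hC1, hC2, hC3⟩, hC0⟩ : ∃ C : ℝ, (C ^ 2 < b ∧ C * R T < √(I T) ∧
      C ^ 2 * Real.log (I T) - 2 * (C * (C * Real.log C)) < J T ^ 2 / I T) ∧ 0 < C := by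
    have hc : Continuous fun C : ℝ => C ^ 2 * Real.log (I T) - 2 * (C * (C * Real.log C)) := by
      have := Real.continuous_mul_log
      fun_prop
    have e1 : ∀ᶠ C : ℝ in 𝓝 0, C ^ 2 < b :=
      (continuous_pow 2).continuousAt.eventually_lt_const (by simpa using hb)
    have e2 : ∀ᶠ C : ℝ in 𝓝 0, C * R T < √(I T) :=
      (continuous_mul_const (R T)).continuousAt.eventually_lt_const
        (by simpa using Real.sqrt_pos.2 hIT)
    have e3 : ∀ᶠ C : ℝ in 𝓝 0,
        C ^ 2 * Real.log (I T) - 2 * (C * (C * Real.log C)) < J T ^ 2 / I T :=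
      hc.continuousAt.eventually_lt_const (by
        simp only [zero_mul, mul_zero, sub_zero, zero_pow two_ne_zero]; positivity)
    have e := (e1.and (e2.and e3)).filter_mono (nhdsWithin_le_nhds (s := Ioi 0))
    exact (e.and self_mem_nhdsWithin).exists
  refine ⟨C, hC0, T, hT.le, fun t ht => ?_⟩
  have hRd : ∀ s, HasDerivAt (fun s => C * R s) (C * deriv R s) s :=
    fun s => ((hR.differentiable two_ne_zero) s).hasDerivAt.const_mul C
  have hBd : ∀ s, T ≤ s → HasDerivAt (fun s => √(I s)) (J s / √(I s)) s := by
    intro s hs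
    refine ((hI s (hT.trans_le hs)).sqrt (hpos s hs).ne').congr_deriv ?_
    have := Real.sqrt_pos.2 (hpos s hs)
    field_simp
  refine image_le_of_deriv_right_lt_deriv_boundary' (a := T) (b := t)
    (fun s _ => (hRd s).continuousAt.continuousWithinAt) (fun s _ => (hRd s).hasDerivWithinAt)
    hC2.le (fun s hs => (hBd s hs.1).continuousAt.continuousWithinAt)
    (fun s hs => (hBd s hs.1).hasDerivWithinAt) (fun s hs heq => ?_) (right_mem_Icc.2 ht)
  have hIs := hpos s hs.1
  have hs0 : 0 < s := hT.trans_le hs.1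
  refine lt_of_pow_lt_pow_left₀ 2 (div_nonneg (hJpos s hs.1).le (Real.sqrt_nonneg _)) ?_
  have hlog : Real.log (I s) = 2 * (Real.log C + Real.log (R s)) := by
    rw [← Real.log_mul hC0.ne' (hRpos s hs0.le).ne', heq, Real.log_sqrt hIs.le]
    ring
  have hE := hEmono (mem_Ici.2 le_rfl) (mem_Ici.2 hs.1) hs.1
  have hlogmono := Real.log_le_log hIT (hImono (mem_Ici.2 le_rfl) (mem_Ici.2 hs.1) hs.1)
  have hprod := mul_le_mul_of_nonneg_left hlogmono (sub_nonneg.2 hC1.le)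
  rw [mul_pow, deriv_sq_eq_two_mul_log hR hR0 hR'0 hRpos hRode hs0.le, div_pow,
    Real.sq_sqrt hIs.le]
  have e : C ^ 2 * (2 * Real.log (R s)) = C ^ 2 * Real.log (I s) - 2 * (C * (C * Real.log C)) := by
    rw [hlog]; ring
  simp only at hE
  rw [e]
  nlinarith

/-- Expansion of a quadratic phase space moment. -/
theorem integral_norm_sq_mul {F : 𝔼 × 𝔼 → ℝ} (hF : Continuous F) (hc : HasCompactSupport F)
    (κ l : ℝ) (a : 𝔼) :
    ∫ p, ‖κ • p.1 + l • p.2 - a‖ ^ 2 * F p =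
      κ ^ 2 * (∫ p, ‖p.1‖ ^ 2 * F p) + 2 * κ * l * (∫ p, inner ℝ p.1 p.2 * F p)
        + l ^ 2 * (∫ p, ‖p.2‖ ^ 2 * F p) - 2 * κ * (∑ i, a i * (∫ p, p.1 i * F p))
        - 2 * l * (∑ i, a i * (∫ p, p.2 i * F p)) + ‖a‖ ^ 2 * (∫ p, F p) := by
  have hi : ∀ φ : 𝔼 × 𝔼 → ℝ, Continuous φ → Integrable fun p => φ p * F p := fun φ hφ =>
    (hφ.mul hF).integrable_of_hasCompactSupport hc.mul_left
  have e : ∀ p : 𝔼 × 𝔼, ‖κ • p.1 + l • p.2 - a‖ ^ 2 * F p =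
      κ ^ 2 * (‖p.1‖ ^ 2 * F p) + 2 * κ * l * (inner ℝ p.1 p.2 * F p)
        + l ^ 2 * (‖p.2‖ ^ 2 * F p) - 2 * κ * (∑ i, a i * (p.1 i * F p))
        - 2 * l * (∑ i, a i * (p.2 i * F p)) + ‖a‖ ^ 2 * F p := by
    intro p
    simp only [EuclideanSpace.real_norm_sq_eq, Fin.sum_univ_two, PiLp.inner_apply, PiLp.add_apply,
      PiLp.sub_apply, PiLp.smul_apply, smul_eq_mul, RCLike.inner_apply, conj_trivial]
    ring
  have h1 := (hi (fun p => ‖p.1‖ ^ 2) (by fun_prop)).const_mul (κ ^ 2)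
  have h2 := (hi (fun p => inner ℝ p.1 p.2) (by fun_prop)).const_mul (2 * κ * l)
  have h3 := (hi (fun p => ‖p.2‖ ^ 2) (by fun_prop)).const_mul (l ^ 2)
  have hx : ∀ i ∈ Finset.univ, Integrable fun p => a i * (p.1 i * F p) := fun i _ =>
    (hi (fun p => p.1 i) (by fun_prop)).const_mul (a i)
  have hv : ∀ i ∈ Finset.univ, Integrable fun p => a i * (p.2 i * F p) := fun i _ =>
    (hi (fun p => p.2 i) (by fun_prop)).const_mul (a i)
  have h4 := (integrable_finsetSum _ hx).const_mul (2 * κ)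
  have h5 := (integrable_finsetSum _ hv).const_mul (2 * l)
  have h6 := (hF.integrable_of_hasCompactSupport hc (μ := volume)).const_mul (‖a‖ ^ 2)
  have h12 := h1.add h2
  have h123 := h12.add h3
  have h1234 := h123.sub h4
  have h12345 := h1234.sub h5
  simp only [Pi.add_def, Pi.sub_def] at h12 h123 h1234 h12345
  simp_rw [e]
  rw [integral_add h12345 h6, integral_sub h1234 h5, integral_sub h123 h4, integral_add h12 h3,
    integral_add h1 h2]
  simp only [integral_const_mul, integral_finsetSum _ hx, integral_finsetSum _ hv]

/-- Integrating out the second variable. -/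
theorem integral_fst_mul {F : 𝔼 × 𝔼 → ℝ} (hF : Continuous F) (hc : HasCompactSupport F)
    {g : 𝔼 → ℝ} (hg : Continuous g) :
    ∫ p, g p.1 * F p = ∫ x, g x * ∫ v, F (x, v) := by
  have hi : Integrable fun p : 𝔼 × 𝔼 => g p.1 * F p :=
    Continuous.integrable_of_hasCompactSupport (by fun_prop) hc.mul_left
  rw [Measure.volume_eq_prod, integral_prod _ hi]
  simp_rw [integral_const_mul]

theorem integral_norm_sub_sq_mul_le {F : 𝔼 × 𝔼 → ℝ} (hF : Continuous F)
    (hc : HasCompactSupport F) (hF0 : ∀ p, 0 ≤ F p) {a : 𝔼} {s : ℝ}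
    (hs : Function.support (fun x => ∫ v, F (x, v)) ⊆ Metric.closedBall a s) :
    ∫ p, ‖p.1 - a‖ ^ 2 * F p ≤ s ^ 2 * ∫ p, F p := by
  rw [← integral_const_mul]
  refine integral_mono
    (Continuous.integrable_of_hasCompactSupport (by fun_prop) hc.mul_left)
    (Continuous.integrable_of_hasCompactSupport (by fun_prop) hc.mul_left) fun p => ?_
  by_cases hp : F p = 0
  · simp [hp]
  have hpos : 0 < ∫ v, F (p.1, v) := by
    refine Continuous.integral_pos_of_hasCompactSupport_nonneg_nonzero (x := p.2) (by fun_prop)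
      ?_ (fun v => hF0 _) hp
    exact HasCompactSupport.intro (hc.isCompact.image continuous_snd) fun v hv =>
      image_eq_zero_of_notMem_tsupport fun h => hv ⟨_, h, rfl⟩
  have hm := hs (Function.mem_support.2 hpos.ne')
  rw [Metric.mem_closedBall, dist_eq_norm] at hm
  have := hF0 p
  dsimp only
  gcongr

/-- for the 2-dimensional Vlasov–Poisson system in the plasma case
`ε = −1`, the minimal radius `r(t)` of closed balls containing the support of
`ρ(t,·)` grows at least like `R(t)`: there are `C > 0` and `T ≥ 0` with
`r(t) ≥ C R(t)` for `t ≥ T`, where `R̈ = 1/R`, `R(0)=1`, `Ṙ(0)=0`. -/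
theorem stmt6
    (f : ℝ → EuclideanSpace ℝ (Fin 2) → EuclideanSpace ℝ (Fin 2) → ℝ)
    (ρ U : ℝ → EuclideanSpace ℝ (Fin 2) → ℝ)
    (R r : ℝ → ℝ) (M : ℝ) (hM : 0 < M)
    -- spatial density and logarithmic potential
    (hρ : ∀ t x, ρ t x = ∫ v, f t x v)
    (hU : ∀ t x, U t x = -(1 / (2 * π)) * ∫ y, Real.log ‖x - y‖ * ρ t y)
    -- the rescaling function: `R̈ = 1/R`, `R(0)=1`, `Ṙ(0)=0`
    (hR : ContDiff ℝ 2 R) (hR0 : R 0 = 1) (hR'0 : deriv R 0 = 0)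
    (hRpos : ∀ t : ℝ, 0 ≤ t → 0 < R t)
    (hRode : ∀ t : ℝ, 0 ≤ t → deriv (deriv R) t = (R t)⁻¹)
    -- `f` is a nonnegative C¹ solution, compactly supported in `(x,v)` locally
    -- uniformly in `t`, with total mass `M`
    (hf_C1 : ContDiff ℝ 1 (fun p : ℝ × EuclideanSpace ℝ (Fin 2) × EuclideanSpace ℝ (Fin 2) =>
      f p.1 p.2.1 p.2.2))
    (hf_nonneg : ∀ t x v, 0 ≤ f t x v)
    (hf_supp : ∀ T₀ : ℝ, ∃ K₀ : ℝ, ∀ t ∈ Icc (0 : ℝ) T₀, ∀ x v,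
      (K₀ ≤ ‖x‖ ∨ K₀ ≤ ‖v‖) → f t x v = 0)
    (hf_mass : ∀ t : ℝ, 0 ≤ t →
      (∫ p : EuclideanSpace ℝ (Fin 2) × EuclideanSpace ℝ (Fin 2), f t p.1 p.2) = M)
    -- the Vlasov equation `∂_t f + v·∇_x f − ∇_x U·∇_v f = 0`
    (hVlasov : ∀ t : ℝ, 0 ≤ t → ∀ x v,
      deriv (fun s => f s x v) t
        + fderiv ℝ (fun y => f t y v) x v
        - fderiv ℝ (fun w => f t x w) v (gradient (fun y => U t y) x) = 0)
    -- `r(t)` is the minimal radius of closed balls containing the support of `ρ(t,·)`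
    (hr : ∀ t : ℝ, 0 ≤ t → IsLeast
      {s : ℝ | 0 ≤ s ∧ ∃ c : EuclideanSpace ℝ (Fin 2),
        Function.support (fun x => ρ t x) ⊆ Metric.closedBall c s} (r t)) :
    ∃ C : ℝ, 0 < C ∧ ∃ T : ℝ, 0 ≤ T ∧ ∀ t : ℝ, T ≤ t → C * R t ≤ r t := by
  have hFC : ∀ t, ContDiff ℝ 1 fun p : 𝔼 × 𝔼 => f t p.1 p.2 := fun t =>
    hf_C1.comp (contDiff_const.prodMk contDiff_id)
  have hFs : ∀ t, 0 ≤ t → HasCompactSupport fun p : 𝔼 × 𝔼 => f t p.1 p.2 := by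
    intro t ht
    obtain ⟨K, hK⟩ := hf_supp t
    refine HasCompactSupport.intro
      ((isCompact_closedBall (0 : 𝔼) K).prod (isCompact_closedBall (0 : 𝔼) K)) fun p hp => ?_
    refine hK t ⟨ht, le_rfl⟩ _ _ ?_
    by_contra! h
    exact hp ⟨by simpa using h.1.le, by simpa using h.2.le⟩
  have hρ' : ∀ t, ρ t = fun x => ∫ v, f t x v := fun t => funext (hρ t)
  have hρC : ∀ t, 0 ≤ t → ContDiff ℝ 1 (ρ t) := fun t ht => by
    rw [hρ']; exact contDiff_integral_snd (hFC t) (hFs t ht)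
  have hρs : ∀ t, 0 ≤ t → HasCompactSupport (ρ t) := fun t ht => by
    rw [hρ']; exact hasCompactSupport_integral_snd (hFs t ht)
  have hfub : ∀ t, 0 ≤ t → ∀ g : 𝔼 → ℝ, Continuous g →
      ∫ p : 𝔼 × 𝔼, g p.1 * f t p.1 p.2 = ∫ x, g x * ρ t x := by
    intro t ht g hg
    rw [integral_fst_mul (hFC t).continuous (hFs t ht) hg, hρ']
  have hρM : ∀ t, 0 ≤ t → ∫ x, ρ t x = M := by
    intro t ht
    have := hfub t ht (fun _ => 1) continuous_const
    simp only [one_mul] at this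
    rw [← this, hf_mass t ht]
  have hpot := fun t ht => logPotential_spec (hρC t ht) (hρs t ht) (hU t)
  have hmom := fun (φ : 𝔼 × 𝔼 → ℝ) (hφ : ContDiff ℝ 1 φ) t (ht : 0 < t) =>
    hasDerivAt_moment hf_C1 hf_supp hVlasov ht (hpot t ht.le).1 hφ
  have hgrad : ∀ t, 0 < t → ∀ (s : ℝ) (a : 𝔼),
      ∫ p : 𝔼 × 𝔼, inner ℝ (gradient (U t) p.1) (s • p.1 + a) * f t p.1 p.2 =
        -(s / (4 * π)) * M ^ 2 := by
    intro t ht s a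
    have hgc : Continuous (gradient (U t)) :=
      (InnerProductSpace.toDual ℝ 𝔼).symm.continuous.comp
        ((hpot t ht.le).1.continuous_fderiv one_ne_zero)
    rw [hfub t ht.le (fun x => inner ℝ (gradient (U t) x) (s • x + a)) (by fun_prop),
      ← hρM t ht.le, ← (hpot t ht.le).2 s a]
    congr 1 with x
    rw [gradient, InnerProductSpace.toDual_symm_apply, mul_comm]
  set c : Fin 2 → ℝ → ℝ := fun i t => ∫ p : 𝔼 × 𝔼, p.1 i * f t p.1 p.2 with hc
  set P : Fin 2 → ℝ → ℝ := fun i t => ∫ p : 𝔼 × 𝔼, p.2 i * f t p.1 p.2 with hP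
  set I₂ : ℝ → ℝ := fun t => ∫ p : 𝔼 × 𝔼, ‖p.1‖ ^ 2 * f t p.1 p.2 with hI₂
  set J₂ : ℝ → ℝ := fun t => ∫ p : 𝔼 × 𝔼, inner ℝ p.1 p.2 * f t p.1 p.2 with hJ₂
  set K₂ : ℝ → ℝ := fun t => ∫ p : 𝔼 × 𝔼, ‖p.2‖ ^ 2 * f t p.1 p.2 with hK₂
  have dc : ∀ i t, 0 < t → HasDerivAt (c i) (P i t) t := by
    intro i t ht
    let L : 𝔼 × 𝔼 →L[ℝ] ℝ := (EuclideanSpace.proj i).comp (ContinuousLinearMap.fst ℝ 𝔼 𝔼)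
    refine (hmom L L.contDiff t ht).congr_deriv ?_
    simp only [ContinuousLinearMap.fderiv]
    rfl
  have dP : ∀ i t, 0 < t → HasDerivAt (P i) 0 t := by
    intro i t ht
    let L : 𝔼 × 𝔼 →L[ℝ] ℝ := (EuclideanSpace.proj i).comp (ContinuousLinearMap.snd ℝ 𝔼 𝔼)
    refine (hmom L L.contDiff t ht).congr_deriv ?_
    have h := hgrad t ht 0 (EuclideanSpace.single i 1)
    simp only [zero_div, neg_zero, zero_mul, zero_smul, zero_add] at h
    rw [← neg_eq_zero, ← integral_neg, ← h]
    congr 1 with p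
    have e : L (p.2, -gradient (U t) p.1) =
        -inner ℝ (gradient (U t) p.1) (EuclideanSpace.single i 1) := by
      generalize gradient (U t) p.1 = g
      simp [L, EuclideanSpace.inner_single_right]
    rw [L.fderiv, e, neg_mul, neg_neg]
  have dI : ∀ t, 0 < t → HasDerivAt I₂ (2 * J₂ t) t := by
    intro t ht
    have hd : ContDiff ℝ 1 fun p : 𝔼 × 𝔼 => ‖p.1‖ ^ 2 := contDiff_fst.norm_sq ℝ
    refine (hmom _ hd t ht).congr_deriv ?_
    rw [hJ₂, ← integral_const_mul]
    congr 1 with p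
    have h1 : HasFDerivAt (fun p : 𝔼 × 𝔼 => ‖p.1‖ ^ 2) _ p :=
      (hasFDerivAt_fst (p := p)).norm_sq
    rw [h1.fderiv]
    simp [mul_assoc]
  have dJ : ∀ t, 0 < t → HasDerivAt J₂ (K₂ t + M ^ 2 / (4 * π)) t := by
    intro t ht
    have hd : ContDiff ℝ 1 fun p : 𝔼 × 𝔼 => inner ℝ p.1 p.2 := contDiff_fst.inner ℝ contDiff_snd
    refine (hmom _ hd t ht).congr_deriv ?_
    have h := hgrad t ht 1 0
    have e : ∀ p : 𝔼 × 𝔼, fderiv ℝ (fun p : 𝔼 × 𝔼 => inner ℝ p.1 p.2) p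
          (p.2, -gradient (U t) p.1) * f t p.1 p.2 =
        ‖p.2‖ ^ 2 * f t p.1 p.2 -
          inner ℝ (gradient (U t) p.1) ((1 : ℝ) • p.1 + 0) * f t p.1 p.2 := by
      intro p
      rw [fderiv_inner_apply ℝ differentiableAt_fst differentiableAt_snd]
      simp [fderiv_fst, fderiv_snd]
      ring
    have hgc : Continuous (gradient (U t)) :=
      (InnerProductSpace.toDual ℝ 𝔼).symm.continuous.comp
        ((hpot t ht.le).1.continuous_fderiv one_ne_zero)
    have hfc := (hFC t).continuous
    simp_rw [e]
    rw [integral_sub, h]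
    · ring
    · exact Continuous.integrable_of_hasCompactSupport (by fun_prop) (hFs t ht.le).mul_left
    · exact Continuous.integrable_of_hasCompactSupport (by fun_prop) (hFs t ht.le).mul_left
  have hexp : ∀ t, 0 ≤ t → ∀ (κ l : ℝ) (a : 𝔼),
      ∫ p : 𝔼 × 𝔼, ‖κ • p.1 + l • p.2 - a‖ ^ 2 * f t p.1 p.2 =
        κ ^ 2 * I₂ t + 2 * κ * l * J₂ t + l ^ 2 * K₂ t - 2 * κ * ∑ i, a i * c i t
          - 2 * l * ∑ i, a i * P i t + ‖a‖ ^ 2 * M := by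
    intro t ht κ l a
    rw [integral_norm_sq_mul (hFC t).continuous (hFs t ht), hf_mass t ht]
  set I : ℝ → ℝ := fun t => I₂ t - (∑ i, c i t ^ 2) / M with hI
  set J : ℝ → ℝ := fun t => J₂ t - (∑ i, c i t * P i t) / M with hJ
  set K : ℝ → ℝ := fun t => K₂ t - (∑ i, P i t ^ 2) / M with hK
  have hquad : ∀ t, 0 ≤ t → ∀ κ l : ℝ,
      0 ≤ κ ^ 2 * I t + 2 * κ * l * J t + l ^ 2 * K t := by
    intro t ht κ l
    have h := hexp t ht κ l (WithLp.toLp 2 fun i => (κ * c i t + l * P i t) / M)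
    have h0 : 0 ≤ ∫ p : 𝔼 × 𝔼, ‖κ • p.1 + l • p.2 -
        (WithLp.toLp 2 fun i => (κ * c i t + l * P i t) / M)‖ ^ 2 * f t p.1 p.2 :=
      integral_nonneg fun p => mul_nonneg (sq_nonneg _) (hf_nonneg _ _ _)
    rw [h] at h0
    refine h0.trans_eq ?_
    simp only [hI, hJ, hK, EuclideanSpace.real_norm_sq_eq, Fin.sum_univ_two]
    field_simp
    ring
  have hIr : ∀ t, 0 ≤ t → I t ≤ r t ^ 2 * M := by
    intro t ht
    obtain ⟨-, a, ha⟩ := (hr t ht).1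
    have h1 := integral_norm_sub_sq_mul_le (hFC t).continuous (hFs t ht)
      (fun p => hf_nonneg t _ _) (a := a) (s := r t) (by simpa only [hρ'] using ha)
    have h2 := hexp t ht 1 0 a
    simp only [one_smul, zero_smul, add_zero] at h2
    rw [h2, hf_mass t ht] at h1
    refine le_trans ?_ h1
    simp only [hI, EuclideanSpace.real_norm_sq_eq, Fin.sum_univ_two]
    have e0 : 0 ≤ ((c 0 t - M * a 0) ^ 2 + (c 1 t - M * a 1) ^ 2) / M := by positivity
    have e1 : ((c 0 t - M * a 0) ^ 2 + (c 1 t - M * a 1) ^ 2) / M =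
        (c 0 t ^ 2 + c 1 t ^ 2) / M - 2 * (a 0 * c 0 t + a 1 * c 1 t)
          + (a 0 ^ 2 + a 1 ^ 2) * M := by
      field_simp
      ring
    linarith
  have dIr : ∀ t, 0 < t → HasDerivAt I (2 * J t) t := by
    intro t ht
    refine ((dI t ht).sub
      ((HasDerivAt.fun_sum fun i _ => (dc i t ht).pow 2).div_const M)).congr_deriv ?_
    simp only [hJ, Fin.sum_univ_two]
    field_simp
    simp
    ring
  have dJr : ∀ t, 0 < t → HasDerivAt J (K t + M ^ 2 / (4 * π)) t := by
    intro t ht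
    refine ((dJ t ht).sub
      ((HasDerivAt.fun_sum fun i _ => (dc i t ht).mul (dP i t ht)).div_const M)).congr_deriv ?_
    simp only [hK, Fin.sum_univ_two]
    field_simp
    ring
  have hdisc : ∀ t, 0 < t → J t ^ 2 ≤ I t * K t := by
    intro t ht
    have h := discrim_le_zero (a := K t) (b := 2 * J t) (c := I t) fun l => by
      have := hquad t ht.le 1 l
      linarith
    rw [discrim] at h
    linarith
  obtain ⟨C, hC, T, hT, hCR⟩ := exists_mul_le_sqrt_of_virial (I := I) (J := J) (K := K)
    (b := M ^ 2 / (4 * π)) (by positivity) dIr dJr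
    (fun t ht => by simpa using hquad t ht.le 0 1) (fun t ht => by simpa using hquad t ht.le 1 0)
    hdisc hR hR0 hR'0 hRpos hRode
  refine ⟨C / √M, by positivity, T, hT, fun t ht => ?_⟩
  have ht0 := hT.trans ht
  have h1 : √(I t) ≤ r t * √M := by
    rw [← Real.sqrt_sq (hr t ht0).1.1, ← Real.sqrt_mul (sq_nonneg _)]
    exact Real.sqrt_le_sqrt (hIr t ht0)
  rw [div_mul_eq_mul_div, div_le_iff₀ (by positivity)]
  exact (hCR t ht).trans h1
end
end

section
/- Let d = 3, ε = −1 (plasma case). Let (ρ,u) be a global C¹ solution on [0,∞)×ℝ³ of the pressureless Euler–Poisson system with ρ(t,·) ≥ 0 compactly supported for each t, and let R solve R̈ = R^{−2}, R(0) = 1, Ṙ(0) = 0. Then ∫_0^∞ Ṙ(s) ( ∫_{ℝ³} |u(s,x) − (Ṙ(s)/R(s))x|² ρ(s,x) dx ) ds < +∞, and limsup_{t→+∞} R(t)^{1/2} ‖∇_x U(t,·)‖_{L²(ℝ³)} < +∞. -/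
open MeasureTheory Set Real Filter
open scoped ENNReal Topology BigOperators

noncomputable section

local notation "𝔼" => EuclideanSpace ℝ (Fin 3)

theorem integrableOn_ball_inv_norm_sq (r : ℝ) :
    IntegrableOn (fun x : 𝔼 => (‖x‖ ^ 2)⁻¹) (Metric.ball 0 r) := by
  rw [integrableOn_fun_norm_addHaar volume (f := fun y => (y ^ 2)⁻¹)]
  have h : IntegrableOn (fun _ : ℝ => (1 : ℝ)) (Ioo 0 r) := by simp
  refine h.congr_fun (fun y hy => ?_) measurableSet_Ioo
  have : y ≠ 0 := hy.1.ne'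
  simp [this]

theorem exists_setIntegral_ball_inv_norm_sq :
    ∃ c : ℝ, 0 ≤ c ∧ ∀ r : ℝ, 0 ≤ r →
      ∫ x in Metric.ball (0 : 𝔼) r, (‖x‖ ^ 2)⁻¹ = c * r := by
  refine ⟨3 * volume.real (Metric.ball (0 : 𝔼) 1), by positivity, fun r hr => ?_⟩
  have h1 : ∫ x in Metric.ball (0 : 𝔼) r, (‖x‖ ^ 2)⁻¹
      = ∫ x : 𝔼, (Iio r).indicator (fun y : ℝ => (y ^ 2)⁻¹) ‖x‖ := by
    rw [← integral_indicator measurableSet_ball]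
    congr 1 with x
    simp [indicator]
  rw [h1, integral_fun_norm_addHaar]
  have h2 : ∀ y ∈ Ioi (0 : ℝ), y ^ (Module.finrank ℝ 𝔼 - 1) •
      (Iio r).indicator (fun y : ℝ => (y ^ 2)⁻¹) y = (Iio r).indicator 1 y := by
    intro y hy
    have : y ≠ 0 := (mem_Ioi.1 hy).ne'
    by_cases hyr : y < r <;> simp [hyr, this]
  rw [setIntegral_congr_fun measurableSet_Ioi h2,
    setIntegral_indicator measurableSet_Iio, Ioi_inter_Iio]
  simp [hr]
  ring

theorem integrable_indicator_inv_norm_pow_four {r : ℝ} (hr : 0 < r) :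
    Integrable (fun x : 𝔼 => (Ioi r).indicator (fun y : ℝ => (y ^ 4)⁻¹) ‖x‖) := by
  rw [integrable_fun_norm_addHaar]
  have h : IntegrableOn ((Ioi r).indicator fun y : ℝ => y ^ (-2 : ℝ)) (Ioi 0) := by
    refine IntegrableOn.integrable_indicator ?_ measurableSet_Ioi |>.integrableOn
    exact integrableOn_Ioi_rpow_of_lt (by norm_num) hr
  refine h.congr_fun (fun y hy => ?_) measurableSet_Ioi
  have hy0 : y ≠ 0 := (mem_Ioi.1 hy).ne'
  by_cases hyr : r < y
  · simp only [mem_Ioi, hyr, indicator_of_mem, finrank_euclideanSpace, Fintype.card_fin, smul_eq_mul]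
    rw [Real.rpow_neg (le_of_lt hy)]
    norm_num
    field_simp
  · simp [hyr]

theorem exists_integral_indicator_inv_norm_pow_four :
    ∃ c : ℝ, 0 ≤ c ∧ ∀ r : ℝ, 0 < r →
      ∫ x : 𝔼, (Ioi r).indicator (fun y : ℝ => (y ^ 4)⁻¹) ‖x‖ = c * r⁻¹ := by
  refine ⟨3 * volume.real (Metric.ball (0 : 𝔼) 1), by positivity, fun r hr => ?_⟩
  rw [integral_fun_norm_addHaar]
  have h2 : ∀ y ∈ Ioi (0 : ℝ), y ^ (Module.finrank ℝ 𝔼 - 1) •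
      (Ioi r).indicator (fun y : ℝ => (y ^ 4)⁻¹) y
        = (Ioi r).indicator (fun y : ℝ => y ^ (-2 : ℝ)) y := by
    intro y hy
    have hy0 : y ≠ 0 := (mem_Ioi.1 hy).ne'
    by_cases hyr : r < y
    · simp only [mem_Ioi, hyr, indicator_of_mem, finrank_euclideanSpace, Fintype.card_fin,
        smul_eq_mul]
      rw [Real.rpow_neg (le_of_lt hy)]
      norm_num
      field_simp
    · simp [hyr]
  rw [setIntegral_congr_fun measurableSet_Ioi h2,
    setIntegral_indicator measurableSet_Ioi, Ioi_inter_Ioi, sup_eq_right.2 hr.le,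
    integral_Ioi_rpow_of_lt (by norm_num) hr]
  norm_num [Real.rpow_neg_one]
  ring

/-- The composition of the kernel `|x|⁻²` with itself is bounded by a multiple of `|x|⁻¹`. -/
theorem exists_lintegral_inv_norm_sq_mul_le :
    ∃ C : ℝ, 0 ≤ C ∧ ∀ y z : 𝔼, y ≠ z →
      ∫⁻ x, ENNReal.ofReal ((‖x - y‖ ^ 2)⁻¹) * ENNReal.ofReal ((‖x - z‖ ^ 2)⁻¹)
        ≤ ENNReal.ofReal (C * ‖y - z‖⁻¹) := by
  obtain ⟨c, hc, hball⟩ := exists_setIntegral_ball_inv_norm_sq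
  obtain ⟨d, hd, hout⟩ := exists_integral_indicator_inv_norm_pow_four
  refine ⟨4 * c + 4 * d, by positivity, fun y z hyz => ?_⟩
  have ha : 0 < ‖y - z‖ := norm_pos_iff.2 (sub_ne_zero.2 hyz)
  set a := ‖y - z‖ with ha_def
  let p : 𝔼 → ℝ := fun x => (4 / a ^ 2) * (Metric.ball (0 : 𝔼) (a / 2)).indicator
    (fun x => (‖x‖ ^ 2)⁻¹) x + (Ioi (a / 4)).indicator (fun y : ℝ => (y ^ 4)⁻¹) ‖x‖ / 2
  have hp_int : Integrable p := by
    refine Integrable.add (Integrable.const_mul ?_ _) (Integrable.div_const ?_ _)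
    · exact (integrableOn_ball_inv_norm_sq _).integrable_indicator measurableSet_ball
    · exact integrable_indicator_inv_norm_pow_four (by positivity)
  have hp_val : ∫ x, p x = (2 * c + 2 * d) * a⁻¹ := by
    rw [integral_add, integral_const_mul, integral_div, integral_indicator measurableSet_ball,
      hball _ (by positivity), hout _ (by positivity)]
    · field_simp
      ring
    · exact ((integrableOn_ball_inv_norm_sq _).integrable_indicator measurableSet_ball).const_mul _
    · exact (integrable_indicator_inv_norm_pow_four (by positivity)).div_const _
  have hp1 : ∀ x, 0 ≤ (Metric.ball (0 : 𝔼) (a / 2)).indicator (fun x => (‖x‖ ^ 2)⁻¹) x :=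
    fun x => indicator_nonneg (fun _ _ => by positivity) x
  have hp2 : ∀ x : 𝔼, 0 ≤ (Ioi (a / 4)).indicator (fun y : ℝ => (y ^ 4)⁻¹) ‖x‖ :=
    fun x => indicator_nonneg (fun _ _ => by positivity) _
  have hp0 : ∀ x, 0 ≤ p x := fun x => by have := hp1 x; have := hp2 x; positivity
  have key : ∀ x, (‖x - y‖ ^ 2)⁻¹ * (‖x - z‖ ^ 2)⁻¹ ≤ p (x - y) + p (x - z) := by
    intro x
    have htri : a ≤ ‖x - y‖ + ‖x - z‖ := by
      have h := norm_sub_le (x - z) (x - y)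
      have h' : (x - z) - (x - y) = y - z := by abel
      rw [h'] at h
      linarith
    have hsmall : ∀ v w : 𝔼, a ≤ ‖v‖ + ‖w‖ → ‖v‖ < a / 2 →
        (‖v‖ ^ 2)⁻¹ * (‖w‖ ^ 2)⁻¹ ≤ p v := by
      intro v w hvw hv
      have hw : a / 2 ≤ ‖w‖ := by linarith
      have hv' : v ∈ Metric.ball (0 : 𝔼) (a / 2) := by simpa using hv
      have : (‖w‖ ^ 2)⁻¹ ≤ 4 / a ^ 2 := by
        have h4 : (4 : ℝ) / a ^ 2 = ((a / 2) ^ 2)⁻¹ := by field_simp; norm_num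
        rw [h4]
        gcongr
      have h2 := hp2 v
      simp only [p, indicator_of_mem hv']
      have := mul_le_mul_of_nonneg_left this (inv_nonneg.2 (sq_nonneg ‖v‖))
      linarith
    by_cases h1 : ‖x - y‖ < a / 2
    · have := hsmall _ _ htri h1
      have := hp0 (x - z)
      linarith
    by_cases h2 : ‖x - z‖ < a / 2
    · have := hsmall (x - z) (x - y) (by linarith) h2
      have := hp0 (x - y)
      linarith
    have h3 : ‖x - y‖ ∈ Ioi (a / 4) := by simp only [mem_Ioi]; linarith
    have h4 : ‖x - z‖ ∈ Ioi (a / 4) := by simp only [mem_Ioi]; linarith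
    have h5 := hp1 (x - y)
    have h6 := hp1 (x - z)
    simp only [p, indicator_of_mem h3, indicator_of_mem h4]
    have h7 : 0 ≤ 4 / a ^ 2 := by positivity
    have h8 := mul_nonneg h7 h5
    have h9 := mul_nonneg h7 h6
    have h10 := sq_nonneg ((‖x - y‖ ^ 2)⁻¹ - (‖x - z‖ ^ 2)⁻¹)
    have e1 : ((‖x - y‖ ^ 4)⁻¹) = ((‖x - y‖ ^ 2)⁻¹) ^ 2 := by rw [← inv_pow]; ring
    have e2 : ((‖x - z‖ ^ 4)⁻¹) = ((‖x - z‖ ^ 2)⁻¹) ^ 2 := by rw [← inv_pow]; ring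
    rw [e1, e2]
    nlinarith
  have hint : Integrable (fun x => p (x - y) + p (x - z)) :=
    (hp_int.comp_sub_right y).add (hp_int.comp_sub_right z)
  calc ∫⁻ x, ENNReal.ofReal ((‖x - y‖ ^ 2)⁻¹) * ENNReal.ofReal ((‖x - z‖ ^ 2)⁻¹)
      ≤ ∫⁻ x, ENNReal.ofReal (p (x - y) + p (x - z)) := by
        refine lintegral_mono fun x => ?_
        rw [← ENNReal.ofReal_mul (by positivity)]
        exact ENNReal.ofReal_le_ofReal (key x)
    _ = ENNReal.ofReal (∫ x, (p (x - y) + p (x - z))) :=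
        (ofReal_integral_eq_lintegral_ofReal hint
          (Eventually.of_forall fun x => add_nonneg (hp0 _) (hp0 _))).symm
    _ = ENNReal.ofReal ((4 * c + 4 * d) * a⁻¹) := by
        rw [integral_add (hp_int.comp_sub_right y) (hp_int.comp_sub_right z),
          integral_sub_right_eq_self p, integral_sub_right_eq_self p, hp_val]
        ring_nf

/-- The kernel `|x - y|⁻²`, truncated to an integrable function on `𝔼 × 𝔼`. -/
def truncatedKernel (M : ℝ) (p : 𝔼 × 𝔼) : ℝ :=
  (Metric.closedBall (0 : 𝔼) M).indicator 1 p.2 *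
    (Metric.ball (0 : 𝔼) (2 * M + 1)).indicator (fun x => (‖x‖ ^ 2)⁻¹) (p.1 - p.2)

theorem integrable_truncatedKernel (M : ℝ) : Integrable (truncatedKernel M) := by
  have h1 : Integrable ((Metric.closedBall (0 : 𝔼) M).indicator (1 : 𝔼 → ℝ)) :=
    (integrable_indicator_iff Metric.isClosed_closedBall.measurableSet).2
      (integrableOn_const (C := (1 : ℝ)) measure_closedBall_lt_top.ne)
  have h2 := (integrableOn_ball_inv_norm_sq (2 * M + 1)).integrable_indicator measurableSet_ball
  exact h1.convolution_integrand (ContinuousLinearMap.mul ℝ ℝ) h2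

theorem truncatedKernel_of_mem {M : ℝ} {p : 𝔼 × 𝔼} (h1 : ‖p.1‖ ≤ M) (h2 : ‖p.2‖ ≤ M) :
    truncatedKernel M p = (‖p.1 - p.2‖ ^ 2)⁻¹ := by
  have h3 : p.2 ∈ Metric.closedBall (0 : 𝔼) M := by simpa using h2
  have h4 : p.1 - p.2 ∈ Metric.ball (0 : 𝔼) (2 * M + 1) := by
    have := norm_sub_le p.1 p.2
    simp only [Metric.mem_ball, dist_zero_right]
    linarith
  simp [truncatedKernel, h3, h4]

theorem truncatedKernel_nonneg (M : ℝ) (p : 𝔼 × 𝔼) : 0 ≤ truncatedKernel M p :=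
  mul_nonneg (indicator_nonneg (fun _ _ => zero_le_one) _)
    (indicator_nonneg (fun _ _ => by positivity) _)

theorem norm_le_const_mul_truncatedKernel {V : Type*} [NormedAddCommGroup V] {g : 𝔼 × 𝔼 → V}
    {C M : ℝ} (hC : 0 ≤ C)
    (hb : ∀ p : 𝔼 × 𝔼, ‖p.1‖ ≤ M → ‖p.2‖ ≤ M → ‖g p‖ ≤ C * (‖p.1 - p.2‖ ^ 2)⁻¹)
    (h0 : ∀ p : 𝔼 × 𝔼, M < ‖p.1‖ ∨ M < ‖p.2‖ → g p = 0) (p : 𝔼 × 𝔼) :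
    ‖g p‖ ≤ C * truncatedKernel M p := by
  by_cases h1 : M < ‖p.1‖ ∨ M < ‖p.2‖
  · rw [h0 p h1, norm_zero]
    exact mul_nonneg hC (truncatedKernel_nonneg M p)
  · push Not at h1
    rw [truncatedKernel_of_mem h1.1 h1.2]
    exact hb p h1.1 h1.2

theorem integrable_of_norm_le_inv_norm_sub_sq {V : Type*} [NormedAddCommGroup V] {g : 𝔼 × 𝔼 → V}
    (hg : AEStronglyMeasurable g) {C M : ℝ} (hC : 0 ≤ C)
    (hb : ∀ p : 𝔼 × 𝔼, ‖p.1‖ ≤ M → ‖p.2‖ ≤ M → ‖g p‖ ≤ C * (‖p.1 - p.2‖ ^ 2)⁻¹)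
    (h0 : ∀ p : 𝔼 × 𝔼, M < ‖p.1‖ ∨ M < ‖p.2‖ → g p = 0) : Integrable g :=
  ((integrable_truncatedKernel M).const_mul C).mono' hg
    (Eventually.of_forall (norm_le_const_mul_truncatedKernel hC hb h0))

theorem inv_norm_sub_le {M : ℝ} {x y : 𝔼} (hx : ‖x‖ ≤ M) (hy : ‖y‖ ≤ M) :
    ‖x - y‖⁻¹ ≤ 2 * M * (‖x - y‖ ^ 2)⁻¹ := by
  have h := norm_sub_le x y
  by_cases h0 : ‖x - y‖ = 0
  · simp [h0]
  · have h1 : 0 < ‖x - y‖ := lt_of_le_of_ne (norm_nonneg _) (Ne.symm h0)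
    have h2 : ‖x - y‖⁻¹ = ‖x - y‖ * (‖x - y‖ ^ 2)⁻¹ := by field_simp
    rw [h2]
    gcongr
    linarith

theorem exists_norm_bound_of_hasCompactSupport {f : 𝔼 → ℝ} (hf : HasCompactSupport f) :
    ∃ M : ℝ, 0 ≤ M ∧ ∀ x, M < ‖x‖ → f x = 0 := by
  obtain ⟨M, hM⟩ := hf.isCompact.isBounded.subset_closedBall (0 : 𝔼)
  refine ⟨max M 0, le_max_right _ _, fun x hx => ?_⟩
  refine image_eq_zero_of_notMem_tsupport fun h => ?_
  have h1 := hM h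
  simp only [Metric.mem_closedBall, dist_zero_right] at h1
  have := lt_of_le_of_lt (le_max_left M 0) hx
  linarith

theorem hasCompactSupport_of_norm_bound {V : Type*} [Zero V] {f : 𝔼 → V} {M : ℝ}
    (h : ∀ x, M < ‖x‖ → f x = 0) : HasCompactSupport f :=
  HasCompactSupport.intro (isCompact_closedBall (0 : 𝔼) M) fun x hx => h x (by simpa using hx)

/-- The Coulomb self-interaction `∬ ρ(x) ρ(y) |x - y|⁻¹ dx dy`. -/
def selfInteraction (ρ : 𝔼 → ℝ) : ℝ := ∫ p : 𝔼 × 𝔼, ρ p.1 * ρ p.2 * ‖p.1 - p.2‖⁻¹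

theorem selfInteraction_nonneg {ρ : 𝔼 → ℝ} (h : ∀ x, 0 ≤ ρ x) : 0 ≤ selfInteraction ρ :=
  integral_nonneg fun p => mul_nonneg (mul_nonneg (h _) (h _)) (by positivity)

theorem integrable_mul_inv_norm_sub {f g : 𝔼 → ℝ} (hf : Continuous f) (hg : Continuous g)
    (hfs : HasCompactSupport f) (hgs : HasCompactSupport g) :
    Integrable (fun p : 𝔼 × 𝔼 => f p.1 * g p.2 * ‖p.1 - p.2‖⁻¹) := by
  obtain ⟨M, hM0, hM⟩ := exists_norm_bound_of_hasCompactSupport hfs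
  obtain ⟨N, hN0, hN⟩ := exists_norm_bound_of_hasCompactSupport hgs
  obtain ⟨A, hA⟩ := hf.bounded_above_of_compact_support hfs
  obtain ⟨B, hB⟩ := hg.bounded_above_of_compact_support hgs
  have hA0 : 0 ≤ A := (norm_nonneg _).trans (hA 0)
  have hB0 : 0 ≤ B := (norm_nonneg _).trans (hB 0)
  refine integrable_of_norm_le_inv_norm_sub_sq (C := A * B * (2 * max M N)) (M := max M N)
    ?_ (by positivity) (fun p h1 h2 => ?_) (fun p hp => ?_)
  · apply Measurable.aestronglyMeasurable
    have := hf.measurable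
    have := hg.measurable
    fun_prop
  · rw [norm_mul, norm_mul, norm_inv, norm_norm, mul_assoc (A * B)]
    gcongr
    · exact hA _
    · exact hB _
    · exact inv_norm_sub_le h1 h2
  · rcases hp with hp | hp
    · simp [hM _ (lt_of_le_of_lt (le_max_left _ _) hp)]
    · simp [hN _ (lt_of_le_of_lt (le_max_right _ _) hp)]

/-- The energy of the field is controlled by the Coulomb self-interaction. -/
theorem exists_integral_norm_field_sq_le :
    ∃ C : ℝ, 0 ≤ C ∧ ∀ ρ : 𝔼 → ℝ, Continuous ρ → HasCompactSupport ρ → (∀ x, 0 ≤ ρ x) →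
      ∫ x, ‖(-(1 / (4 * π))) • ∫ y, (ρ y * (‖x - y‖ ^ 3)⁻¹) • (x - y)‖ ^ 2
        ≤ C * selfInteraction ρ := by
  obtain ⟨C, hC, hker⟩ := exists_lintegral_inv_norm_sq_mul_le
  refine ⟨C, hC, fun ρ hρ hρs hρ0 => ?_⟩
  set G : 𝔼 → 𝔼 := fun x => (-(1 / (4 * π))) • ∫ y, (ρ y * (‖x - y‖ ^ 3)⁻¹) • (x - y) with hG
  have hm := hρ.measurable
  have hpt : ∀ x, ENNReal.ofReal (‖G x‖ ^ 2) ≤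
      (∫⁻ y, ENNReal.ofReal (ρ y) * ENNReal.ofReal ((‖x - y‖ ^ 2)⁻¹)) ^ 2 := by
    intro x
    rw [ENNReal.ofReal_pow (norm_nonneg _)]
    gcongr
    have h4 : ‖(-(1 / (4 * π)))‖ ≤ 1 := by
      rw [norm_neg, Real.norm_eq_abs, abs_of_pos (by positivity), div_le_one (by positivity)]
      linarith [Real.pi_gt_three]
    have h5 : ‖G x‖ ≤ ‖∫ y, (ρ y * (‖x - y‖ ^ 3)⁻¹) • (x - y)‖ := by
      rw [hG, norm_smul]
      exact mul_le_of_le_one_left (norm_nonneg _) h4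
    refine (ENNReal.ofReal_le_ofReal h5).trans ?_
    rw [ofReal_norm]
    refine (enorm_integral_le_lintegral_enorm _).trans (lintegral_mono fun y => ?_)
    rw [← ENNReal.ofReal_mul (hρ0 y), ← ofReal_norm]
    refine ENNReal.ofReal_le_ofReal ?_
    rw [norm_smul, norm_mul, Real.norm_of_nonneg (hρ0 y), norm_inv, norm_pow, norm_norm, mul_assoc]
    refine mul_le_mul_of_nonneg_left ?_ (hρ0 y)
    by_cases h : ‖x - y‖ = 0
    · simp [h]
    · refine le_of_eq ?_
      field_simp
  have hsq : ∀ x, (∫⁻ y, ENNReal.ofReal (ρ y) * ENNReal.ofReal ((‖x - y‖ ^ 2)⁻¹)) ^ 2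
      = ∫⁻ p : 𝔼 × 𝔼, (ENNReal.ofReal (ρ p.1) * ENNReal.ofReal ((‖x - p.1‖ ^ 2)⁻¹)) *
        (ENNReal.ofReal (ρ p.2) * ENNReal.ofReal ((‖x - p.2‖ ^ 2)⁻¹)) := by
    intro x
    have hmx : AEMeasurable
        (fun y => ENNReal.ofReal (ρ y) * ENNReal.ofReal ((‖x - y‖ ^ 2)⁻¹)) volume :=
      Measurable.aemeasurable (by fun_prop)
    rw [sq, Measure.volume_eq_prod]
    exact (lintegral_prod_mul hmx hmx).symm
  have hdiag : ∀ᵐ p : 𝔼 × 𝔼, p.1 ≠ p.2 := by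
    rw [Measure.volume_eq_prod]
    refine Measure.ae_prod_iff_ae_ae ?_ |>.2 (Eventually.of_forall fun x => ?_)
    · exact (measurableSet_eq_fun measurable_fst measurable_snd).compl
    · have : ∀ᵐ y : 𝔼, y ≠ x := by simp [ae_iff]
      filter_upwards [this] with y hy using hy.symm
  have hint := integrable_mul_inv_norm_sub hρ hρ hρs hρs
  have htot : ∫⁻ x, ENNReal.ofReal (‖G x‖ ^ 2) ≤ ENNReal.ofReal (C * selfInteraction ρ) := by
    calc ∫⁻ x, ENNReal.ofReal (‖G x‖ ^ 2)
        ≤ ∫⁻ x, ∫⁻ p : 𝔼 × 𝔼, (ENNReal.ofReal (ρ p.1) * ENNReal.ofReal ((‖x - p.1‖ ^ 2)⁻¹)) *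
            (ENNReal.ofReal (ρ p.2) * ENNReal.ofReal ((‖x - p.2‖ ^ 2)⁻¹)) :=
          lintegral_mono fun x => (hpt x).trans_eq (hsq x)
      _ = ∫⁻ p : 𝔼 × 𝔼, ∫⁻ x, (ENNReal.ofReal (ρ p.1) * ENNReal.ofReal ((‖x - p.1‖ ^ 2)⁻¹)) *
            (ENNReal.ofReal (ρ p.2) * ENNReal.ofReal ((‖x - p.2‖ ^ 2)⁻¹)) :=
          lintegral_lintegral_swap (Measurable.aemeasurable (by
            simp only [Function.uncurry_def]; fun_prop))
      _ ≤ ∫⁻ p : 𝔼 × 𝔼, ENNReal.ofReal (C * (ρ p.1 * ρ p.2 * ‖p.1 - p.2‖⁻¹)) := by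
          refine lintegral_mono_ae ?_
          filter_upwards [hdiag] with p hp
          have e : ∀ x, (ENNReal.ofReal (ρ p.1) * ENNReal.ofReal ((‖x - p.1‖ ^ 2)⁻¹)) *
            (ENNReal.ofReal (ρ p.2) * ENNReal.ofReal ((‖x - p.2‖ ^ 2)⁻¹))
            = (ENNReal.ofReal (ρ p.1) * ENNReal.ofReal (ρ p.2)) *
              (ENNReal.ofReal ((‖x - p.1‖ ^ 2)⁻¹) * ENNReal.ofReal ((‖x - p.2‖ ^ 2)⁻¹)) :=
            fun x => by ring
          simp_rw [e]
          rw [lintegral_const_mul _ (by fun_prop)]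
          refine (mul_le_mul_right (hker _ _ hp) _).trans_eq ?_
          rw [← ENNReal.ofReal_mul (hρ0 _),
            ← ENNReal.ofReal_mul (mul_nonneg (hρ0 _) (hρ0 _))]
          congr 1
          ring
      _ = ENNReal.ofReal (∫ p : 𝔼 × 𝔼, C * (ρ p.1 * ρ p.2 * ‖p.1 - p.2‖⁻¹)) := by
          refine (ofReal_integral_eq_lintegral_ofReal (hint.const_mul C)
            (Eventually.of_forall fun p => ?_)).symm
          exact mul_nonneg hC (mul_nonneg (mul_nonneg (hρ0 _) (hρ0 _)) (by positivity))
      _ = ENNReal.ofReal (C * selfInteraction ρ) := by rw [integral_const_mul, selfInteraction]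
  have hnn : 0 ≤ C * selfInteraction ρ := mul_nonneg hC (selfInteraction_nonneg hρ0)
  have h := norm_integral_le_lintegral_norm (μ := volume) (fun x => ‖G x‖ ^ 2)
  simp only [norm_pow, norm_norm] at h
  refine (le_abs_self _).trans (h.trans ?_)
  exact ENNReal.toReal_le_of_le_ofReal hnn htot

/-- The divergence of a vector field on `ℝ³`. -/
def divergence (v : 𝔼 → 𝔼) (x : 𝔼) : ℝ :=
  ∑ i : Fin 3, fderiv ℝ (fun y => v y i) x (EuclideanSpace.single i 1)

theorem contDiff_component {v : 𝔼 → 𝔼} (hv : ContDiff ℝ 1 v) (i : Fin 3) :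
    ContDiff ℝ 1 (fun y => v y i) := by fun_prop

theorem hasCompactSupport_component {v : 𝔼 → 𝔼} (hv : HasCompactSupport v) (i : Fin 3) :
    HasCompactSupport (fun y => v y i) :=
  hv.comp_left (g := fun w : 𝔼 => w i) rfl

theorem continuous_divergence {v : 𝔼 → 𝔼} (hv : ContDiff ℝ 1 v) : Continuous (divergence v) :=
  continuous_finsetSum _ fun i _ =>
    ((contDiff_component hv i).continuous_fderiv one_ne_zero).clm_apply continuous_const

theorem hasCompactSupport_divergence {v : 𝔼 → 𝔼} (hs : HasCompactSupport v) :
    HasCompactSupport (divergence v) := by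
  refine HasCompactSupport.intro hs.isCompact fun x hx => Finset.sum_eq_zero fun i _ => ?_
  have h : v =ᶠ[𝓝 x] 0 := notMem_tsupport_iff_eventuallyEq.1 hx
  have h' : (fun y => v y i) =ᶠ[𝓝 x] fun _ => (0 : ℝ) := by
    filter_upwards [h] with y hy
    simp [hy]
  rw [h'.fderiv_eq]
  simp

theorem integral_divergence_mul {v : 𝔼 → 𝔼} {φ : 𝔼 → ℝ} (hv : ContDiff ℝ 1 v)
    (hs : HasCompactSupport v) (hφ : ContDiff ℝ 1 φ) :
    ∫ x, divergence v x * φ x = -∫ x, fderiv ℝ φ x (v x) := by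
  have hcont : ∀ i, Continuous fun x => fderiv ℝ (fun y => v y i) x (EuclideanSpace.single i 1) :=
    fun i => ((contDiff_component hv i).continuous_fderiv one_ne_zero).clm_apply continuous_const
  have hcontφ : ∀ i : Fin 3, Continuous fun x => fderiv ℝ φ x (EuclideanSpace.single i 1) :=
    fun i => (hφ.continuous_fderiv one_ne_zero).clm_apply continuous_const
  have hvi := fun i => contDiff_component hv i
  have hsi := fun i => hasCompactSupport_component hs i
  have I1 : ∀ i, Integrable fun x =>
      fderiv ℝ (fun y => v y i) x (EuclideanSpace.single i 1) * φ x := fun i =>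
    ((hcont i).mul hφ.continuous).integrable_of_hasCompactSupport
      (((hsi i).fderiv_apply ℝ _).mul_right)
  have I2 : ∀ i, Integrable fun x => v x i * fderiv ℝ φ x (EuclideanSpace.single i 1) := fun i =>
    ((hvi i).continuous.mul (hcontφ i)).integrable_of_hasCompactSupport (hsi i).mul_right
  have e1 : ∀ x, divergence v x * φ x =
      ∑ i : Fin 3, fderiv ℝ (fun y => v y i) x (EuclideanSpace.single i 1) * φ x := fun x => by
    rw [divergence, Finset.sum_mul]
  have e2 : ∀ x, fderiv ℝ φ x (v x) =
      ∑ i : Fin 3, v x i * fderiv ℝ φ x (EuclideanSpace.single i 1) := fun x => by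
    conv_lhs => rw [← (EuclideanSpace.basisFun (Fin 3) ℝ).sum_repr (v x)]
    rw [map_sum]
    simp
  simp_rw [e1, e2]
  rw [integral_finsetSum _ fun i _ => I1 i, integral_finsetSum _ fun i _ => I2 i,
    ← Finset.sum_neg_distrib]
  refine Finset.sum_congr rfl fun i _ => ?_
  rw [integral_mul_fderiv_eq_neg_fderiv_mul_of_integrable (I1 i) (I2 i), neg_neg]
  · exact ((hvi i).continuous.mul hφ.continuous).integrable_of_hasCompactSupport (hsi i).mul_right
  · exact fun x _ => ((hvi i).differentiable one_ne_zero) x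
  · exact fun x _ => (hφ.differentiable one_ne_zero) x

theorem hasFDerivAt_inv_sqrt_norm_sq_add {ε : ℝ} (hε : 0 < ε) (x : 𝔼) :
    HasFDerivAt (fun x : 𝔼 => (√(‖x‖ ^ 2 + ε))⁻¹)
      (-((√(‖x‖ ^ 2 + ε)) ^ 3)⁻¹ • innerSL ℝ x) x := by
  have hpos : 0 < ‖x‖ ^ 2 + ε := by positivity
  have h1 : HasFDerivAt (fun x : 𝔼 => ‖x‖ ^ 2 + ε) (2 • innerSL ℝ x) x :=
    (hasStrictFDerivAt_norm_sq x).hasFDerivAt.add_const ε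
  have h2 := (Real.hasDerivAt_sqrt hpos.ne').inv (Real.sqrt_pos.2 hpos).ne'
  have h3 := h2.comp_hasFDerivAt x h1
  convert! h3 using 1
  ext v
  simp
  field_simp

theorem integral_divergence_mul_inv_norm_zero {v : 𝔼 → 𝔼} (hv : ContDiff ℝ 1 v)
    (hs : HasCompactSupport v) :
    ∫ x, divergence v x * ‖x‖⁻¹ = ∫ x, (‖x‖ ^ 3)⁻¹ * inner ℝ x (v x) := by
  obtain ⟨M, hM⟩ := hs.isCompact.isBounded.subset_ball (0 : 𝔼)
  obtain ⟨A, hA⟩ := (continuous_divergence hv).bounded_above_of_compact_support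
    (hasCompactSupport_divergence hs)
  obtain ⟨B, hB⟩ := hv.continuous.bounded_above_of_compact_support hs
  have hB0 : 0 ≤ B := (norm_nonneg _).trans (hB 0)
  have hA0 : 0 ≤ A := (norm_nonneg _).trans (hA 0)
  have hM0 : ∀ x, x ∉ Metric.ball (0 : 𝔼) M → v x = 0 := fun x hx =>
    image_eq_zero_of_notMem_tsupport fun h => hx (hM h)
  obtain ⟨N, hN⟩ := (hasCompactSupport_divergence hs).isCompact.isBounded.subset_ball (0 : 𝔼)
  have hN0 : ∀ x, x ∉ Metric.ball (0 : 𝔼) N → divergence v x = 0 := fun x hx =>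
    image_eq_zero_of_notMem_tsupport fun h => hx (hN h)
  have hker := fun r => (integrableOn_ball_inv_norm_sq r).integrable_indicator measurableSet_ball
  have hε : ∀ n : ℕ, (0 : ℝ) < 1 / ((n : ℝ) + 1) := fun n => by positivity
  have hlimε : ∀ x : 𝔼, Tendsto (fun n : ℕ => √(‖x‖ ^ 2 + 1 / ((n : ℝ) + 1))) atTop (𝓝 ‖x‖) := by
    intro x
    have h := (tendsto_one_div_add_atTop_nhds_zero_nat (𝕜 := ℝ)).const_add (‖x‖ ^ 2)
    have h' := (Real.continuous_sqrt.tendsto _).comp h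
    rwa [add_zero, Real.sqrt_sq (norm_nonneg x)] at h'
  have hle : ∀ (x : 𝔼) (n : ℕ), ‖x‖ ≤ √(‖x‖ ^ 2 + 1 / ((n : ℝ) + 1)) := fun x n => by
    refine Real.le_sqrt_of_sq_le ?_
    linarith [hε n]
  have hne : ∀ᵐ x : 𝔼, x ≠ 0 := by simp [ae_iff]
  have hmv := hv.continuous.measurable
  have hmd := (continuous_divergence hv).measurable
  have L1 : Tendsto (fun n : ℕ => ∫ x, divergence v x * (√(‖x‖ ^ 2 + 1 / ((n : ℝ) + 1)))⁻¹) atTop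
      (𝓝 (∫ x, divergence v x * ‖x‖⁻¹)) := by
    refine tendsto_integral_of_dominated_convergence
      (fun x => A * |N| * (Metric.ball (0 : 𝔼) N).indicator (fun x => (‖x‖ ^ 2)⁻¹) x)
      (fun n => Measurable.aestronglyMeasurable (by fun_prop)) ((hker N).const_mul _) (fun n => ?_)
      ?_
    · filter_upwards [hne] with x hx
      by_cases hxN : x ∈ Metric.ball (0 : 𝔼) N
      · have hx0 : 0 < ‖x‖ := norm_pos_iff.2 hx
        have hxN' : ‖x‖ < N := by simpa using hxN
        rw [indicator_of_mem hxN, norm_mul, norm_inv, Real.norm_of_nonneg (Real.sqrt_nonneg _),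
          mul_assoc A]
        refine mul_le_mul (hA x) ?_ (by positivity) hA0
        calc (√(‖x‖ ^ 2 + 1 / ((n : ℝ) + 1)))⁻¹ ≤ ‖x‖⁻¹ := by gcongr; exact hle x n
          _ = ‖x‖ * (‖x‖ ^ 2)⁻¹ := by field_simp
          _ ≤ |N| * (‖x‖ ^ 2)⁻¹ := by
            gcongr
            exact hxN'.le.trans (le_abs_self N)
      · rw [hN0 x hxN, indicator_of_notMem hxN]
        simp
    · filter_upwards [hne] with x hx
      exact ((hlimε x).inv₀ (norm_ne_zero_iff.2 hx)).const_mul _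
  have L2 : Tendsto (fun n : ℕ => ∫ x, ((√(‖x‖ ^ 2 + 1 / ((n : ℝ) + 1))) ^ 3)⁻¹ * inner ℝ x (v x))
      atTop (𝓝 (∫ x, (‖x‖ ^ 3)⁻¹ * inner ℝ x (v x))) := by
    refine tendsto_integral_of_dominated_convergence
      (fun x => B * (Metric.ball (0 : 𝔼) M).indicator (fun x => (‖x‖ ^ 2)⁻¹) x)
      (fun n => Measurable.aestronglyMeasurable (by fun_prop)) ((hker M).const_mul _) (fun n => ?_)
      ?_
    · filter_upwards [hne] with x hx
      by_cases hxM : x ∈ Metric.ball (0 : 𝔼) M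
      · have hx0 : 0 < ‖x‖ := norm_pos_iff.2 hx
        rw [indicator_of_mem hxM, norm_mul, norm_inv, norm_pow,
          Real.norm_of_nonneg (Real.sqrt_nonneg _)]
        calc ((√(‖x‖ ^ 2 + 1 / ((n : ℝ) + 1))) ^ 3)⁻¹ * ‖inner ℝ x (v x)‖
            ≤ (‖x‖ ^ 3)⁻¹ * (‖x‖ * B) := by
              gcongr
              · exact hle x n
              · exact (norm_inner_le_norm _ _).trans (by gcongr; exact hB x)
          _ = B * (‖x‖ ^ 2)⁻¹ := by field_simp
      · rw [hM0 x hxM, indicator_of_notMem hxM]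
        simp
    · filter_upwards [hne] with x hx
      exact (((hlimε x).pow 3).inv₀ (pow_ne_zero 3 (norm_ne_zero_iff.2 hx))).mul_const _
  refine tendsto_nhds_unique L1 (L2.congr fun n => ?_)
  have hφ : ContDiff ℝ 1 (fun x : 𝔼 => (√(‖x‖ ^ 2 + 1 / ((n : ℝ) + 1)))⁻¹) := by
    have hpos : ∀ x : 𝔼, ‖x‖ ^ 2 + 1 / ((n : ℝ) + 1) ≠ 0 := fun x => by positivity
    have h1 : ContDiff ℝ 1 (fun x : 𝔼 => ‖x‖ ^ 2 + 1 / ((n : ℝ) + 1)) :=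
      (contDiff_norm_sq ℝ).add contDiff_const
    exact (h1.sqrt hpos).inv fun x => (Real.sqrt_pos.2 (by positivity)).ne'
  rw [integral_divergence_mul hv hs hφ, ← integral_neg]
  congr 1 with x
  rw [(hasFDerivAt_inv_sqrt_norm_sq_add (hε n) x).fderiv]
  simp

theorem integral_divergence_mul_inv_norm_sub {v : 𝔼 → 𝔼} (hv : ContDiff ℝ 1 v)
    (hs : HasCompactSupport v) (y : 𝔼) :
    ∫ x, divergence v x * ‖x - y‖⁻¹ = ∫ x, (‖x - y‖ ^ 3)⁻¹ * inner ℝ (x - y) (v x) := by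
  have hv' : ContDiff ℝ 1 (fun x => v (x + y)) := by fun_prop
  have hs' : HasCompactSupport (fun x => v (x + y)) := hs.comp_homeomorph (Homeomorph.addRight y)
  have h := integral_divergence_mul_inv_norm_zero hv' hs'
  have e : ∀ x, divergence (fun x => v (x + y)) x = divergence v (x + y) := fun x => by
    refine Finset.sum_congr rfl fun i _ => ?_
    rw [fderiv_comp_add_right (f := fun z => v z i)]
  simp_rw [e] at h
  rw [← integral_add_right_eq_self _ y]
  rw [← integral_add_right_eq_self (fun x => (‖x - y‖ ^ 3)⁻¹ * inner ℝ (x - y) (v x)) y]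
  simpa using h

theorem hasDerivAt_time {V : Type*} [NormedAddCommGroup V] [NormedSpace ℝ V] {g : ℝ → 𝔼 → V}
    (hg : ContDiff ℝ 1 fun p : ℝ × 𝔼 => g p.1 p.2) (s : ℝ) (x : 𝔼) :
    HasDerivAt (fun s => g s x) (fderiv ℝ (fun p : ℝ × 𝔼 => g p.1 p.2) (s, x) (1, 0)) s := by
  have h1 := ((hg.differentiable one_ne_zero) (s, x)).hasFDerivAt
  have h2 : HasDerivAt (fun s : ℝ => (s, x)) ((1 : ℝ), (0 : 𝔼)) s :=
    (hasDerivAt_id s).prodMk (hasDerivAt_const s x)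
  exact h1.comp_hasDerivAt s h2

theorem contDiff_slice {V : Type*} [NormedAddCommGroup V] [NormedSpace ℝ V] {g : ℝ → 𝔼 → V}
    (hg : ContDiff ℝ 1 fun p : ℝ × 𝔼 => g p.1 p.2) (s : ℝ) : ContDiff ℝ 1 (g s) :=
  hg.comp (contDiff_const.prodMk contDiff_id)

theorem hasDerivAt_integral_of_contDiff {g : ℝ → 𝔼 → ℝ}
    (hg : ContDiff ℝ 1 fun p : ℝ × 𝔼 => g p.1 p.2) {t δ M : ℝ} (hδ : 0 < δ)
    (h0 : ∀ s, |s - t| < δ → ∀ x, M < ‖x‖ → g s x = 0) :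
    HasDerivAt (fun s => ∫ x, g s x) (∫ x, deriv (fun s => g s x) t) t := by
  have hd : ∀ s x, HasDerivAt (fun s => g s x)
      (fderiv ℝ (fun p : ℝ × 𝔼 => g p.1 p.2) (s, x) (1, 0)) s := hasDerivAt_time hg
  have hc : Continuous fun p : ℝ × 𝔼 => fderiv ℝ (fun p : ℝ × 𝔼 => g p.1 p.2) p (1, 0) :=
    (hg.continuous_fderiv one_ne_zero).clm_apply continuous_const
  obtain ⟨C, hC⟩ := (isCompact_Icc (a := t - δ / 2) (b := t + δ / 2)).prod
    (isCompact_closedBall (0 : 𝔼) M) |>.exists_bound_of_continuousOn hc.continuousOn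
  have hgc : ∀ s, Continuous (g s) := fun s =>
    hg.continuous.comp (Continuous.prodMk continuous_const continuous_id)
  have heq : (fun x => deriv (fun s => g s x) t) =
      fun x => fderiv ℝ (fun p : ℝ × 𝔼 => g p.1 p.2) (t, x) (1, 0) :=
    funext fun x => (hd t x).deriv
  rw [heq]
  refine (hasDerivAt_integral_of_dominated_loc_of_deriv_le (F := g)
    (F' := fun s x => fderiv ℝ (fun p : ℝ × 𝔼 => g p.1 p.2) (s, x) (1, 0))
    (bound := (Metric.closedBall (0 : 𝔼) M).indicator fun _ => C)
    (Metric.ball_mem_nhds t (half_pos hδ)) (Eventually.of_forall fun s =>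
    (hgc s).aestronglyMeasurable) ?_ ?_ ?_ ?_ ?_).2
  · exact (hgc t).integrable_of_hasCompactSupport
      (hasCompactSupport_of_norm_bound (h0 t (by simpa using hδ)))
  · exact (hc.comp (Continuous.prodMk continuous_const continuous_id)).aestronglyMeasurable
  · refine Eventually.of_forall fun x s hs => ?_
    have hs' : |s - t| < δ / 2 := by simpa [Real.dist_eq] using hs
    by_cases hx : x ∈ Metric.closedBall (0 : 𝔼) M
    · rw [indicator_of_mem hx]
      obtain ⟨h1, h2⟩ := abs_lt.1 hs'
      exact hC (s, x) ⟨⟨by linarith, by linarith⟩, hx⟩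
    · rw [indicator_of_notMem hx]
      have hx' : M < ‖x‖ := by simpa using hx
      have : (fun s => g s x) =ᶠ[𝓝 s] fun _ => 0 := by
        have : Metric.ball t δ ∈ 𝓝 s :=
          Metric.isOpen_ball.mem_nhds (Metric.ball_subset_ball (half_le_self hδ.le) hs)
        filter_upwards [this] with r hr
        exact h0 r (by simpa [Real.dist_eq] using hr) x hx'
      rw [← (hd s x).deriv, this.deriv_eq]
      simp
  · exact (integrable_indicator_iff Metric.isClosed_closedBall.measurableSet).2
      (integrableOn_const measure_closedBall_lt_top.ne)
  · exact Eventually.of_forall fun x s _ => hd s x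

theorem continuousOn_integral_of_norm_bound {g : ℝ → 𝔼 → ℝ}
    (hg : Continuous fun p : ℝ × 𝔼 => g p.1 p.2) {c d M : ℝ}
    (h0 : ∀ s ∈ Icc c d, ∀ x, M < ‖x‖ → g s x = 0) :
    ContinuousOn (fun s => ∫ x, g s x) (Icc c d) := by
  obtain ⟨C, hC⟩ := (isCompact_Icc (a := c) (b := d)).prod
    (isCompact_closedBall (0 : 𝔼) M) |>.exists_bound_of_continuousOn hg.continuousOn
  have hgc : ∀ s, Continuous (g s) := fun s =>
    hg.comp (Continuous.prodMk continuous_const continuous_id)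
  refine continuousOn_of_dominated (bound := (Metric.closedBall (0 : 𝔼) M).indicator fun _ => C)
    (fun s _ => (hgc s).aestronglyMeasurable) (fun s hs => Eventually.of_forall fun x => ?_)
    ?_ (Eventually.of_forall fun x => ?_)
  · by_cases hx : x ∈ Metric.closedBall (0 : 𝔼) M
    · rw [indicator_of_mem hx]
      exact hC (s, x) ⟨hs, hx⟩
    · rw [indicator_of_notMem hx, h0 s hs x (by simpa using hx), norm_zero]
  · exact (integrable_indicator_iff Metric.isClosed_closedBall.measurableSet).2
      (integrableOn_const measure_closedBall_lt_top.ne)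
  · exact (hg.comp (Continuous.prodMk continuous_id continuous_const)).continuousOn

theorem integrable_field_integrand {ρ : 𝔼 → ℝ} (hρ : Continuous ρ) (hs : HasCompactSupport ρ)
    (x : 𝔼) : Integrable (fun y => (ρ y * (‖x - y‖ ^ 3)⁻¹) • (x - y)) := by
  obtain ⟨M, hM0, hM⟩ := exists_norm_bound_of_hasCompactSupport hs
  obtain ⟨B, hB⟩ := hρ.bounded_above_of_compact_support hs
  have hm := hρ.measurable
  have hker := (integrableOn_ball_inv_norm_sq (‖x‖ + M + 1)).integrable_indicator measurableSet_ball
  refine ((hker.comp_sub_left x).const_mul B).mono' (Measurable.aestronglyMeasurable (by fun_prop))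
    (Eventually.of_forall fun y => ?_)
  have hB0 : 0 ≤ B := (norm_nonneg _).trans (hB 0)
  by_cases hy : M < ‖y‖
  · rw [hM y hy]
    simp only [zero_mul, zero_smul, norm_zero]
    exact mul_nonneg hB0 (indicator_nonneg (fun _ _ => by positivity) _)
  · have hmem : x - y ∈ Metric.ball (0 : 𝔼) (‖x‖ + M + 1) := by
      have := norm_sub_le x y
      simp only [Metric.mem_ball, dist_zero_right]
      linarith
    rw [indicator_of_mem hmem, norm_smul, norm_mul, norm_inv, norm_pow, norm_norm, mul_assoc]
    refine mul_le_mul (hB y) (le_of_eq ?_) (by positivity) hB0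
    by_cases h : ‖x - y‖ = 0
    · simp [h]
    · field_simp

theorem integrable_field_work {ρ : 𝔼 → ℝ} {w : 𝔼 → 𝔼} (hρ : Continuous ρ)
    (hs : HasCompactSupport ρ) (hw : Continuous w) :
    Integrable (fun p : 𝔼 × 𝔼 =>
      ρ p.1 * ρ p.2 * (‖p.1 - p.2‖ ^ 3)⁻¹ * inner ℝ (w p.1) (p.1 - p.2)) := by
  obtain ⟨M, hM0, hM⟩ := exists_norm_bound_of_hasCompactSupport hs
  obtain ⟨B, hB⟩ := hρ.bounded_above_of_compact_support hs
  obtain ⟨W, hW⟩ := (hρ.smul hw).bounded_above_of_compact_support hs.smul_right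
  have hB0 : 0 ≤ B := (norm_nonneg _).trans (hB 0)
  have hW0 : 0 ≤ W := (norm_nonneg _).trans (hW 0)
  have hm := hρ.measurable
  have hmw := hw.measurable
  refine integrable_of_norm_le_inv_norm_sub_sq (C := B * W) (M := M)
    (Measurable.aestronglyMeasurable (by fun_prop)) (by positivity) (fun p h1 h2 => ?_)
    (fun p hp => ?_)
  · have e : ρ p.1 * ρ p.2 * (‖p.1 - p.2‖ ^ 3)⁻¹ * inner ℝ (w p.1) (p.1 - p.2)
        = ρ p.2 * (‖p.1 - p.2‖ ^ 3)⁻¹ * inner ℝ (ρ p.1 • w p.1) (p.1 - p.2) := by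
      rw [real_inner_smul_left]
      ring
    rw [e, norm_mul, norm_mul, norm_inv, norm_pow, norm_norm]
    calc ‖ρ p.2‖ * (‖p.1 - p.2‖ ^ 3)⁻¹ * ‖inner ℝ (ρ p.1 • w p.1) (p.1 - p.2)‖
        ≤ B * (‖p.1 - p.2‖ ^ 3)⁻¹ * (W * ‖p.1 - p.2‖) := by
          gcongr
          · exact hB _
          · exact (norm_inner_le_norm _ _).trans (by gcongr; exact hW p.1)
      _ = B * W * (‖p.1 - p.2‖ ^ 2)⁻¹ := by
          by_cases h : ‖p.1 - p.2‖ = 0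
          · simp [h]
          · field_simp
  · rcases hp with hp | hp <;> simp [hM _ hp]

theorem integral_mul_inner_field {ρ : 𝔼 → ℝ} {w : 𝔼 → 𝔼} (hρ : Continuous ρ)
    (hs : HasCompactSupport ρ) (hw : Continuous w) :
    ∫ x, ρ x * inner ℝ (w x)
        ((-(1 / (4 * π))) • ∫ y, (ρ y * (‖x - y‖ ^ 3)⁻¹) • (x - y))
      = -(1 / (4 * π)) * ∫ p : 𝔼 × 𝔼,
        ρ p.1 * ρ p.2 * (‖p.1 - p.2‖ ^ 3)⁻¹ * inner ℝ (w p.1) (p.1 - p.2) := by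
  have hint := integrable_field_work hρ hs hw
  rw [Measure.volume_eq_prod] at hint ⊢
  rw [integral_prod _ hint, ← integral_const_mul]
  congr 1 with x
  rw [real_inner_smul_right, ← integral_inner (integrable_field_integrand hρ hs x),
    mul_left_comm, ← integral_const_mul]
  congr 2 with y
  rw [real_inner_smul_right]
  ring

theorem integral_mul_inner_self_field {ρ : 𝔼 → ℝ} (hρ : Continuous ρ)
    (hs : HasCompactSupport ρ) :
    ∫ x, ρ x * inner ℝ x
        ((-(1 / (4 * π))) • ∫ y, (ρ y * (‖x - y‖ ^ 3)⁻¹) • (x - y))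
      = -(1 / (8 * π)) * selfInteraction ρ := by
  rw [integral_mul_inner_field (w := fun x => x) hρ hs continuous_id]
  have hint := integrable_field_work (w := fun x => x) hρ hs continuous_id
  set I := ∫ p : 𝔼 × 𝔼, ρ p.1 * ρ p.2 * (‖p.1 - p.2‖ ^ 3)⁻¹ * inner ℝ p.1 (p.1 - p.2) with hI
  have hswap : I = ∫ p : 𝔼 × 𝔼,
      ρ p.2 * ρ p.1 * (‖p.2 - p.1‖ ^ 3)⁻¹ * inner ℝ p.2 (p.2 - p.1) := by
    rw [hI, Measure.volume_eq_prod, ← integral_prod_swap]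
    rfl
  have hint' : Integrable (fun p : 𝔼 × 𝔼 =>
      ρ p.2 * ρ p.1 * (‖p.2 - p.1‖ ^ 3)⁻¹ * inner ℝ p.2 (p.2 - p.1)) := by
    rw [Measure.volume_eq_prod] at hint ⊢
    exact hint.swap
  have h2 : I + I = selfInteraction ρ := by
    nth_rewrite 2 [hswap]
    rw [hI, ← integral_add hint hint', selfInteraction]
    congr 1 with p
    have e : inner ℝ p.2 (p.2 - p.1) = - inner ℝ p.2 (p.1 - p.2) := by
      rw [← inner_neg_right, neg_sub]
    rw [norm_sub_rev p.2 p.1, e]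
    have e2 : inner ℝ p.1 (p.1 - p.2) - inner ℝ p.2 (p.1 - p.2) = ‖p.1 - p.2‖ ^ 2 := by
      rw [← inner_sub_left, real_inner_self_eq_norm_sq]
    have e3 : (‖p.1 - p.2‖ ^ 3)⁻¹ * ‖p.1 - p.2‖ ^ 2 = ‖p.1 - p.2‖⁻¹ := by
      by_cases h : ‖p.1 - p.2‖ = 0
      · simp [h]
      · field_simp
    rw [← e3, ← e2]
    ring
  rw [← h2]
  field_simp
  ring

/-- Classical solutions of the repulsive pressureless Euler–Poisson system for `t ≥ 0`. -/
structure IsEulerPoissonSolution (ρ : ℝ → 𝔼 → ℝ) (u F : ℝ → 𝔼 → 𝔼) : Prop where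
  field_eq : ∀ t x, F t x = (-(1 / (4 * π))) • ∫ y, (ρ t y * (‖x - y‖ ^ 3)⁻¹) • (x - y)
  contDiff_density : ContDiff ℝ 1 (fun p : ℝ × 𝔼 => ρ p.1 p.2)
  contDiff_velocity : ContDiff ℝ 1 (fun p : ℝ × 𝔼 => u p.1 p.2)
  density_nonneg : ∀ t x, 0 ≤ ρ t x
  hasCompactSupport_density : ∀ t : ℝ, HasCompactSupport (fun x => ρ t x)
  continuity_eq : ∀ t : ℝ, 0 ≤ t → ∀ x,
    deriv (fun s => ρ s x) t
      + ∑ i : Fin 3, fderiv ℝ (fun y => ρ t y * u t y i) x (EuclideanSpace.single i 1) = 0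
  momentum_eq : ∀ t : ℝ, 0 ≤ t → ∀ x,
    deriv (fun s => u s x) t + fderiv ℝ (fun y => u t y) x (u t x) + F t x = 0

namespace IsEulerPoissonSolution

variable {ρ : ℝ → EuclideanSpace ℝ (Fin 3) → ℝ}
  {u F : ℝ → EuclideanSpace ℝ (Fin 3) → EuclideanSpace ℝ (Fin 3)}

theorem contDiff_momentum (h : IsEulerPoissonSolution ρ u F) (t : ℝ) :
    ContDiff ℝ 1 (fun x => ρ t x • u t x) :=
  (contDiff_slice h.contDiff_density t).smul (contDiff_slice h.contDiff_velocity t)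

theorem hasCompactSupport_momentum (h : IsEulerPoissonSolution ρ u F) (t : ℝ) :
    HasCompactSupport (fun x => ρ t x • u t x) :=
  (h.hasCompactSupport_density t).smul_right

theorem deriv_density (h : IsEulerPoissonSolution ρ u F) {t : ℝ} (ht : 0 ≤ t) (x : 𝔼) :
    deriv (fun s => ρ s x) t = -divergence (fun x => ρ t x • u t x) x :=
  eq_neg_of_add_eq_zero_left (h.continuity_eq t ht x)

/-- The weak form of the continuity equation. -/
theorem hasDerivAt_integral_density_mul (h : IsEulerPoissonSolution ρ u F) {ψ : ℝ → 𝔼 → ℝ}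
    (hψ : ContDiff ℝ 1 fun p : ℝ × 𝔼 => ψ p.1 p.2) {c d t M : ℝ} (hc : 0 ≤ c) (ht : t ∈ Ioo c d)
    (hM : ∀ s ∈ Icc c d, ∀ x, M < ‖x‖ → ρ s x * ψ s x = 0) :
    HasDerivAt (fun s => ∫ x, ρ s x * ψ s x)
      (∫ x, ρ t x * (deriv (fun s => ψ s x) t + fderiv ℝ (ψ t) x (u t x))) t := by
  have hδ : 0 < min (t - c) (d - t) := lt_min (sub_pos.2 ht.1) (sub_pos.2 ht.2)
  have key := hasDerivAt_integral_of_contDiff (t := t) (g := fun s x => ρ s x * ψ s x)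
    (h.contDiff_density.mul hψ) hδ (M := M) (fun s hs x hx => by
      obtain ⟨h1, h2⟩ := lt_min_iff.1 hs
      refine hM s ⟨?_, ?_⟩ x hx
      · linarith [(abs_lt.1 h1).1]
      · linarith [(abs_lt.1 h2).2])
  convert! key using 1
  have ht0 : 0 ≤ t := hc.trans ht.1.le
  have hρt := (contDiff_slice h.contDiff_density t).continuous
  have hut := (contDiff_slice h.contDiff_velocity t).continuous
  have hψt := contDiff_slice hψ t
  have hcs := h.hasCompactSupport_density t
  have hdψ : Continuous fun x => deriv (fun s => ψ s x) t := by
    have : (fun x => deriv (fun s => ψ s x) t) =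
      fun x => fderiv ℝ (fun p : ℝ × 𝔼 => ψ p.1 p.2) (t, x) (1, 0) :=
      funext fun x => (hasDerivAt_time hψ t x).deriv
    rw [this]
    exact ((hψ.continuous_fderiv one_ne_zero).clm_apply continuous_const).comp
      (Continuous.prodMk continuous_const continuous_id)
  have hv := h.contDiff_momentum t
  have hvs := h.hasCompactSupport_momentum t
  have e : ∀ x, deriv (fun s => ρ s x * ψ s x) t =
      ρ t x * deriv (fun s => ψ s x) t
        - divergence (fun x => ρ t x • u t x) x * ψ t x := fun x => by
    rw [deriv_fun_mul (hasDerivAt_time h.contDiff_density t x).differentiableAt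
      (hasDerivAt_time hψ t x).differentiableAt, h.deriv_density ht0]
    ring
  have I1 : Integrable fun x => ρ t x * deriv (fun s => ψ s x) t :=
    (hρt.mul hdψ).integrable_of_hasCompactSupport hcs.mul_right
  have I2 : Integrable fun x => divergence (fun x => ρ t x • u t x) x * ψ t x :=
    ((continuous_divergence hv).mul hψt.continuous).integrable_of_hasCompactSupport
      (hasCompactSupport_divergence hvs).mul_right
  have I3 : Integrable fun x => ρ t x * fderiv ℝ (ψ t) x (u t x) :=
    (hρt.mul ((hψt.continuous_fderiv one_ne_zero).clm_apply hut)).integrable_of_hasCompactSupport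
      hcs.mul_right
  simp_rw [e, mul_add]
  rw [integral_sub I1 I2, integral_add I1 I3, integral_divergence_mul hv hvs hψt]
  simp

theorem hasDerivAt_selfInteraction (h : IsEulerPoissonSolution ρ u F) {c d t M : ℝ} (hc : 0 ≤ c)
    (ht : t ∈ Ioo c d) (hM : ∀ s ∈ Icc c d, ∀ x, M < ‖x‖ → ρ s x = 0) :
    HasDerivAt (fun s => selfInteraction (ρ s)) (8 * π * ∫ x, ρ t x * inner ℝ (u t x) (F t x))
      t := by
  have ht0 : 0 ≤ t := hc.trans ht.1.le
  have hρ := h.contDiff_density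
  set D : ℝ → 𝔼 → ℝ := fun s x => fderiv ℝ (fun p : ℝ × 𝔼 => ρ p.1 p.2) (s, x) (1, 0) with hD
  have hDc : Continuous fun p : ℝ × 𝔼 => D p.1 p.2 :=
    (hρ.continuous_fderiv one_ne_zero).clm_apply continuous_const
  have hd : ∀ s x, HasDerivAt (fun s => ρ s x) (D s x) s := hasDerivAt_time hρ
  have hD0 : ∀ s ∈ Ioo c d, ∀ x, M < ‖x‖ → D s x = 0 := fun s hs x hx => by
    have : (fun s => ρ s x) =ᶠ[𝓝 s] fun _ => 0 := by
      filter_upwards [Ioo_mem_nhds hs.1 hs.2] with r hr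
      exact hM r (Ioo_subset_Icc_self hr) x hx
    rw [← (hd s x).deriv, this.deriv_eq]
    simp
  have hK := (isCompact_Icc (a := c) (b := d)).prod (isCompact_closedBall (0 : 𝔼) M)
  obtain ⟨A, hA⟩ := hK.exists_bound_of_continuousOn hρ.continuous.continuousOn
  obtain ⟨B, hB⟩ := hK.exists_bound_of_continuousOn hDc.continuousOn
  have hslice : ∀ {g : ℝ → 𝔼 → ℝ}, (Continuous fun p : ℝ × 𝔼 => g p.1 p.2) → ∀ s, Continuous (g s) :=
    fun hg s => hg.comp (Continuous.prodMk continuous_const continuous_id)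
  have hρs := hslice hρ.continuous
  have hDs := hslice hDc
  have hDeq : D t = -divergence (fun x => ρ t x • u t x) :=
    funext fun x => (hd t x).deriv.symm.trans (h.deriv_density ht0 x)
  have hDsupp : HasCompactSupport (D t) := hasCompactSupport_of_norm_bound (hD0 t ht)
  have hcs := h.hasCompactSupport_density t
  have key := (hasDerivAt_integral_of_dominated_loc_of_deriv_le (μ := (volume : Measure (𝔼 × 𝔼)))
    (F := fun s p => ρ s p.1 * ρ s p.2 * ‖p.1 - p.2‖⁻¹)
    (F' := fun s p => (D s p.1 * ρ s p.2 + ρ s p.1 * D s p.2) * ‖p.1 - p.2‖⁻¹)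
    (bound := fun p => (B * A + A * B) * (2 * |M|) * truncatedKernel M p)
    (Ioo_mem_nhds ht.1 ht.2) (Eventually.of_forall fun s => ?_) ?_ ?_ ?_ ?_ ?_).2
  · convert! key using 1
    have I1 := integrable_mul_inv_norm_sub (hDs t) (hρs t) hDsupp hcs
    have I2 := integrable_mul_inv_norm_sub (hρs t) (hDs t) hcs hDsupp
    have hcu := (contDiff_slice h.contDiff_velocity t).continuous
    simp_rw [add_mul]
    rw [integral_add I1 I2]
    have hsw : ∫ p : 𝔼 × 𝔼, ρ t p.1 * D t p.2 * ‖p.1 - p.2‖⁻¹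
        = ∫ p : 𝔼 × 𝔼, D t p.1 * ρ t p.2 * ‖p.1 - p.2‖⁻¹ := by
      rw [Measure.volume_eq_prod, ← integral_prod_swap]
      congr 1 with p
      simp only [Prod.fst_swap, Prod.snd_swap]
      rw [norm_sub_rev p.2 p.1]
      ring
    have hI : ∫ p : 𝔼 × 𝔼, D t p.1 * ρ t p.2 * ‖p.1 - p.2‖⁻¹
        = -∫ p : 𝔼 × 𝔼,
          ρ t p.1 * ρ t p.2 * (‖p.1 - p.2‖ ^ 3)⁻¹ * inner ℝ (u t p.1) (p.1 - p.2) := by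
      have I3 := integrable_field_work (hρs t) hcs hcu
      rw [Measure.volume_eq_prod] at I1 I3 ⊢
      rw [integral_prod_symm _ I1, integral_prod_symm _ I3, ← integral_neg]
      congr 1 with y
      have e1 : ∀ x, D t x * ρ t y * ‖x - y‖⁻¹
          = -(ρ t y * (divergence (fun x => ρ t x • u t x) x * ‖x - y‖⁻¹)) := fun x => by
        rw [hDeq, Pi.neg_apply]
        ring
      simp_rw [e1]
      rw [integral_neg, integral_const_mul,
        integral_divergence_mul_inv_norm_sub (h.contDiff_momentum t)
          (h.hasCompactSupport_momentum t), ← integral_const_mul]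
      congr 2 with x
      rw [real_inner_smul_right, real_inner_comm]
      ring
    have hwork : ∫ x, ρ t x * inner ℝ (u t x) (F t x) = -(1 / (4 * π)) * ∫ p : 𝔼 × 𝔼,
        ρ t p.1 * ρ t p.2 * (‖p.1 - p.2‖ ^ 3)⁻¹ * inner ℝ (u t p.1) (p.1 - p.2) := by
      simp_rw [h.field_eq t]
      exact integral_mul_inner_field (hρs t) hcs hcu
    rw [hsw, hI, hwork]
    field_simp
    ring
  · have := (hρs s).measurable
    exact Measurable.aestronglyMeasurable (by fun_prop)
  · exact integrable_mul_inv_norm_sub (hρs t) (hρs t) hcs hcs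
  · have := (hρs t).measurable
    have := (hDs t).measurable
    exact Measurable.aestronglyMeasurable (by fun_prop)
  · refine Eventually.of_forall fun p s hs => ?_
    have hs' := Ioo_subset_Icc_self hs
    rcases lt_or_ge M 0 with hMneg | hMnn
    · have hp : M < ‖p.1‖ := hMneg.trans_le (norm_nonneg _)
      have hp2 : M < ‖p.2‖ := hMneg.trans_le (norm_nonneg _)
      rw [hM s hs' _ hp, hM s hs' _ hp2]
      simp only [mul_zero, zero_mul, add_zero, norm_zero]
      have hz : truncatedKernel M p = 0 := by
        simp [truncatedKernel, Metric.closedBall_eq_empty.2 hMneg]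
      rw [hz, mul_zero]
    have hA0 : 0 ≤ A := (norm_nonneg _).trans (hA (s, 0) ⟨hs', by simpa using hMnn⟩)
    have hB0 : 0 ≤ B := (norm_nonneg _).trans (hB (s, 0) ⟨hs', by simpa using hMnn⟩)
    refine norm_le_const_mul_truncatedKernel
      (g := fun p : 𝔼 × 𝔼 => (D s p.1 * ρ s p.2 + ρ s p.1 * D s p.2) * ‖p.1 - p.2‖⁻¹)
      (by positivity) (fun q h1 h2 => ?_) (fun q hq => ?_) p
    · have m1 : (s, q.1) ∈ Icc c d ×ˢ Metric.closedBall (0 : 𝔼) M := ⟨hs', by simpa using h1⟩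
      have m2 : (s, q.2) ∈ Icc c d ×ˢ Metric.closedBall (0 : 𝔼) M := ⟨hs', by simpa using h2⟩
      have a1 := hA _ m1
      have a2 := hA _ m2
      have b1 := hB _ m1
      have b2 := hB _ m2
      rw [norm_mul, norm_inv, norm_norm, mul_assoc (B * A + A * B)]
      refine mul_le_mul ?_ ?_ (by positivity) (by positivity)
      · refine (norm_add_le _ _).trans ?_
        rw [norm_mul, norm_mul]
        gcongr
      · rw [abs_of_nonneg hMnn]
        exact inv_norm_sub_le h1 h2
    · rcases hq with hq | hq <;> simp [hM s hs' _ hq, hD0 s hs _ hq]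
  · exact (integrable_truncatedKernel M).const_mul _
  · exact Eventually.of_forall fun p s _ => (((hd s p.1).mul (hd s p.2)).mul_const _)

theorem continuousOn_selfInteraction (h : IsEulerPoissonSolution ρ u F) {c d M : ℝ}
    (hM : ∀ s ∈ Icc c d, ∀ x, M < ‖x‖ → ρ s x = 0) :
    ContinuousOn (fun s => selfInteraction (ρ s)) (Icc c d) := by
  have hρ := h.contDiff_density
  have hK := (isCompact_Icc (a := c) (b := d)).prod (isCompact_closedBall (0 : 𝔼) |M|)
  obtain ⟨A, hA⟩ := hK.exists_bound_of_continuousOn hρ.continuous.continuousOn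
  have hρs : ∀ s, Continuous (ρ s) := fun s => (contDiff_slice hρ s).continuous
  refine continuousOn_of_dominated
    (bound := fun p => A * A * (2 * |M|) * truncatedKernel |M| p) (fun s _ => ?_)
    (fun s hs => Eventually.of_forall fun p => ?_) ?_ (Eventually.of_forall fun p => ?_)
  · have := (hρs s).measurable
    exact Measurable.aestronglyMeasurable (by fun_prop)
  · have hA0 : 0 ≤ A := (norm_nonneg _).trans (hA (s, 0) ⟨hs, by simp⟩)
    refine norm_le_const_mul_truncatedKernel
      (g := fun p : 𝔼 × 𝔼 => ρ s p.1 * ρ s p.2 * ‖p.1 - p.2‖⁻¹) (by positivity)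
      (fun q h1 h2 => ?_) (fun q hq => ?_) p
    · have a1 := hA (s, q.1) ⟨hs, by simpa using h1⟩
      have a2 := hA (s, q.2) ⟨hs, by simpa using h2⟩
      rw [norm_mul, norm_inv, norm_norm, norm_mul, mul_assoc (A * A)]
      refine mul_le_mul ?_ (inv_norm_sub_le h1 h2) (by positivity) (by positivity)
      gcongr
    · rcases hq with hq | hq <;> simp [hM s hs _ (lt_of_le_of_lt (le_abs_self M) hq)]
  · exact (integrable_truncatedKernel _).const_mul _
  · have : ∀ x, Continuous fun s => ρ s x := fun x =>
      hρ.continuous.comp (Continuous.prodMk continuous_id continuous_const)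
    exact (((this p.1).mul (this p.2)).mul continuous_const).continuousOn

end IsEulerPoissonSolution

theorem exists_support_bound_of_locally {ρ : ℝ → 𝔼 → ℝ} {c d : ℝ} (hc : 0 ≤ c)
    (hgood : ∀ t ∈ Icc c d, ∃ δ > 0, ∃ M, ∀ s, 0 ≤ s → |s - t| < δ → ∀ x, M < ‖x‖ → ρ s x = 0) :
    ∃ M, ∀ s ∈ Icc c d, ∀ x, M < ‖x‖ → ρ s x = 0 := by
  refine isCompact_Icc.induction_on (p := fun S => ∃ M, ∀ s ∈ S, ∀ x, M < ‖x‖ → ρ s x = 0)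
    ⟨0, by simp⟩ (fun S S' hSS' ⟨M, hM⟩ => ⟨M, fun s hs => hM s (hSS' hs)⟩) ?_ ?_
  · rintro S S' ⟨M, hM⟩ ⟨M', hM'⟩
    refine ⟨max M M', fun s hs x hx => ?_⟩
    rcases hs with hs | hs
    · exact hM s hs x ((le_max_left _ _).trans_lt hx)
    · exact hM' s hs x ((le_max_right _ _).trans_lt hx)
  · intro t ht
    obtain ⟨δ, hδ, M, hM⟩ := hgood t ht
    refine ⟨Metric.ball t δ ∩ Icc c d, inter_mem (mem_nhdsWithin_of_mem_nhds
      (Metric.ball_mem_nhds t hδ)) self_mem_nhdsWithin, M, fun s hs => ?_⟩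
    exact hM s (hc.trans hs.2.1) (by simpa [Real.dist_eq] using hs.1)

theorem eq_of_hasDerivAt_zero {f : ℝ → ℝ} {c d : ℝ} (hf : ContinuousOn f (Icc c d))
    (hd : ∀ t ∈ Ioo c d, HasDerivAt f 0 t) {s t : ℝ} (hs : s ∈ Icc c d) (ht : t ∈ Icc c d) :
    f s = f t := by
  have key : ∀ r ∈ Icc c d, f r = f c := by
    intro r hr
    rcases eq_or_lt_of_le hr.1 with h | h
    · rw [h]
    · obtain ⟨z, _, hz⟩ := exists_hasDerivAt_eq_slope f (fun _ => 0) h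
        (hf.mono (Icc_subset_Icc_right hr.2))
        fun x hx => hd x ⟨hx.1, hx.2.trans_le hr.2⟩
      have : f r - f c = 0 := by
        rcases div_eq_zero_iff.1 hz.symm with h' | h'
        · exact h'
        · linarith
      linarith
  rw [key s hs, key t ht]

namespace IsEulerPoissonSolution

variable {ρ : ℝ → EuclideanSpace ℝ (Fin 3) → ℝ}
  {u F : ℝ → EuclideanSpace ℝ (Fin 3) → EuclideanSpace ℝ (Fin 3)}

theorem continuous_density (h : IsEulerPoissonSolution ρ u F) (t : ℝ) : Continuous (ρ t) :=
  (contDiff_slice h.contDiff_density t).continuous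

theorem continuous_velocity (h : IsEulerPoissonSolution ρ u F) (t : ℝ) : Continuous (u t) :=
  (contDiff_slice h.contDiff_velocity t).continuous

theorem continuous_field (h : IsEulerPoissonSolution ρ u F) {t : ℝ} (ht : 0 ≤ t) :
    Continuous (F t) := by
  have e : F t = fun x => -(fderiv ℝ (fun p : ℝ × 𝔼 => u p.1 p.2) (t, x) (1, 0)
      + fderiv ℝ (u t) x (u t x)) := by
    funext x
    rw [← (hasDerivAt_time h.contDiff_velocity t x).deriv]
    exact (neg_eq_of_add_eq_zero_right (h.momentum_eq t ht x)).symm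
  rw [e]
  have h1 : Continuous fun x => fderiv ℝ (fun p : ℝ × 𝔼 => u p.1 p.2) (t, x) (1, 0) :=
    ((h.contDiff_velocity.continuous_fderiv one_ne_zero).clm_apply continuous_const).comp
      (Continuous.prodMk continuous_const continuous_id)
  exact (h1.add (((contDiff_slice h.contDiff_velocity t).continuous_fderiv one_ne_zero).clm_apply
    (h.continuous_velocity t))).neg

theorem integrable_density_mul (h : IsEulerPoissonSolution ρ u F) (t : ℝ) {φ : 𝔼 → ℝ}
    (hφ : Continuous φ) : Integrable fun x => ρ t x * φ x :=
  ((h.continuous_density t).mul hφ).integrable_of_hasCompactSupport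
    (h.hasCompactSupport_density t).mul_right

theorem integrable_density (h : IsEulerPoissonSolution ρ u F) (t : ℝ) : Integrable (ρ t) :=
  (h.continuous_density t).integrable_of_hasCompactSupport (h.hasCompactSupport_density t)

theorem hasDerivAt_integral_speed_sq (h : IsEulerPoissonSolution ρ u F) {c d t M : ℝ} (hc : 0 ≤ c)
    (ht : t ∈ Ioo c d) (hM : ∀ s ∈ Icc c d, ∀ x, M < ‖x‖ → ρ s x = 0) :
    HasDerivAt (fun s => ∫ x, ρ s x * ‖u s x‖ ^ 2)
      (-2 * ∫ x, ρ t x * inner ℝ (u t x) (F t x)) t := by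
  have hψ : ContDiff ℝ 1 fun p : ℝ × 𝔼 => ‖u p.1 p.2‖ ^ 2 := h.contDiff_velocity.norm_sq ℝ
  have key := h.hasDerivAt_integral_density_mul (ψ := fun s x => ‖u s x‖ ^ 2) hψ hc ht
    (M := M) fun s hs x hx => by rw [hM s hs x hx, zero_mul]
  convert! key using 1
  rw [← integral_const_mul]
  congr 1 with x
  have h1 := (hasDerivAt_time h.contDiff_velocity t x).norm_sq
  have h2 := ((contDiff_slice h.contDiff_velocity t).differentiable one_ne_zero x).hasFDerivAt.norm_sq
  have h3 := h.momentum_eq t (hc.trans ht.1.le) x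
  rw [(hasDerivAt_time h.contDiff_velocity t x).deriv] at h3
  rw [h1.deriv, h2.fderiv, eq_neg_of_add_eq_zero_right h3]
  simp only [inner_neg_right, inner_add_right, _root_.smul_apply,
    ContinuousLinearMap.comp_apply, innerSL_apply_apply, nsmul_eq_mul, Nat.cast_ofNat]
  ring

theorem hasDerivAt_integral_radial_velocity (h : IsEulerPoissonSolution ρ u F) {c d t M : ℝ}
    (hc : 0 ≤ c) (ht : t ∈ Ioo c d) (hM : ∀ s ∈ Icc c d, ∀ x, M < ‖x‖ → ρ s x = 0) :
    HasDerivAt (fun s => ∫ x, ρ s x * inner ℝ (u s x) x)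
      ((∫ x, ρ t x * ‖u t x‖ ^ 2) + 1 / (8 * π) * selfInteraction (ρ t)) t := by
  have hψ : ContDiff ℝ 1 fun p : ℝ × 𝔼 => (inner ℝ (u p.1 p.2) p.2 : ℝ) :=
    h.contDiff_velocity.inner ℝ contDiff_snd
  have key := h.hasDerivAt_integral_density_mul (ψ := fun s x => inner ℝ (u s x) x) hψ hc ht
    (M := M) fun s hs x hx => by rw [hM s hs x hx, zero_mul]
  convert! key using 1
  have ht0 := hc.trans ht.1.le
  have hvir := integral_mul_inner_self_field (h.continuous_density t)
    (h.hasCompactSupport_density t)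
  simp_rw [← h.field_eq t] at hvir
  have I1 := h.integrable_density_mul t (φ := fun x => ‖u t x‖ ^ 2)
    ((h.continuous_velocity t).norm.pow 2)
  have I2 := h.integrable_density_mul t (φ := fun x => inner ℝ x (F t x))
    (continuous_id.inner (h.continuous_field ht0))
  have e : (∫ x, ρ t x * ‖u t x‖ ^ 2) + 1 / (8 * π) * selfInteraction (ρ t)
      = (∫ x, ρ t x * ‖u t x‖ ^ 2) - ∫ x, ρ t x * inner ℝ x (F t x) := by
    rw [hvir]
    ring
  rw [e, ← integral_sub I1 I2]
  congr 1 with x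
  have h1 := (hasDerivAt_time h.contDiff_velocity t x).inner ℝ (hasDerivAt_const t x)
  have h2 := ((contDiff_slice h.contDiff_velocity t).differentiable one_ne_zero x).hasFDerivAt.inner
    ℝ (hasFDerivAt_id x)
  have h3 := h.momentum_eq t ht0 x
  rw [(hasDerivAt_time h.contDiff_velocity t x).deriv] at h3
  have h2' : fderiv ℝ (fun x => (inner ℝ (u t x) x : ℝ)) x (u t x)
      = inner ℝ (u t x) (u t x) + inner ℝ (fderiv ℝ (u t) x (u t x)) x := by
    rw [show (fun x => (inner ℝ (u t x) x : ℝ)) = fun x => inner ℝ (u t x) (id x) from rfl,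
      h2.fderiv]
    simp
  rw [h1.deriv, h2', eq_neg_of_add_eq_zero_right h3, real_inner_self_eq_norm_sq]
  simp only [inner_zero_right, inner_neg_right, inner_add_right, zero_add]
  rw [real_inner_comm x, real_inner_comm x]
  ring

theorem hasDerivAt_integral_norm_sq (h : IsEulerPoissonSolution ρ u F) {c d t M : ℝ}
    (hc : 0 ≤ c) (ht : t ∈ Ioo c d) (hM : ∀ s ∈ Icc c d, ∀ x, M < ‖x‖ → ρ s x = 0) :
    HasDerivAt (fun s => ∫ x, ρ s x * ‖x‖ ^ 2) (2 * ∫ x, ρ t x * inner ℝ (u t x) x) t := by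
  have hψ : ContDiff ℝ 1 fun p : ℝ × 𝔼 => ‖p.2‖ ^ 2 := contDiff_snd.norm_sq ℝ
  have key := h.hasDerivAt_integral_density_mul (ψ := fun s x => ‖x‖ ^ 2) hψ hc ht
    (M := M) fun s hs x hx => by rw [hM s hs x hx, zero_mul]
  convert! key using 1
  rw [← integral_const_mul]
  congr 1 with x
  have h2' : fderiv ℝ (fun x : 𝔼 => ‖x‖ ^ 2) x (u t x) = 2 * inner ℝ x (u t x) := by
    rw [(hasStrictFDerivAt_norm_sq x).hasFDerivAt.fderiv]
    simp
  rw [h2', real_inner_comm, deriv_const]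
  ring

theorem continuousOn_integral_density_mul (h : IsEulerPoissonSolution ρ u F) {ψ : ℝ → 𝔼 → ℝ}
    (hψ : Continuous fun p : ℝ × 𝔼 => ψ p.1 p.2) {c d M : ℝ}
    (hM : ∀ s ∈ Icc c d, ∀ x, M < ‖x‖ → ρ s x * ψ s x = 0) :
    ContinuousOn (fun s => ∫ x, ρ s x * ψ s x) (Icc c d) :=
  continuousOn_integral_of_norm_bound (g := fun s x => ρ s x * ψ s x)
    (h.contDiff_density.continuous.mul hψ) hM

theorem mass_eq_of_support_bound (h : IsEulerPoissonSolution ρ u F) {c d M : ℝ} (hc : 0 ≤ c)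
    (hM : ∀ s ∈ Icc c d, ∀ x, M < ‖x‖ → ρ s x = 0) {s t : ℝ} (hs : s ∈ Icc c d)
    (ht : t ∈ Icc c d) : ∫ x, ρ s x = ∫ x, ρ t x := by
  refine eq_of_hasDerivAt_zero (f := fun s => ∫ x, ρ s x)
    (continuousOn_integral_of_norm_bound h.contDiff_density.continuous hM)
    (fun r hr => ?_) hs ht
  have key := h.hasDerivAt_integral_density_mul (ψ := fun _ _ => 1) contDiff_const hc hr
    (M := M) fun s hs x hx => by rw [hM s hs x hx, zero_mul]
  simpa using key

theorem energy_eq_of_support_bound (h : IsEulerPoissonSolution ρ u F) {c d M : ℝ} (hc : 0 ≤ c)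
    (hM : ∀ s ∈ Icc c d, ∀ x, M < ‖x‖ → ρ s x = 0) {s t : ℝ} (hs : s ∈ Icc c d)
    (ht : t ∈ Icc c d) :
    (∫ x, ρ s x * ‖u s x‖ ^ 2) + 1 / (4 * π) * selfInteraction (ρ s)
      = (∫ x, ρ t x * ‖u t x‖ ^ 2) + 1 / (4 * π) * selfInteraction (ρ t) := by
  refine eq_of_hasDerivAt_zero
    (f := fun s => (∫ x, ρ s x * ‖u s x‖ ^ 2) + 1 / (4 * π) * selfInteraction (ρ s))
    (ContinuousOn.add ?_ ((h.continuousOn_selfInteraction hM).const_mul _)) (fun r hr => ?_) hs ht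
  · exact h.continuousOn_integral_density_mul (M := M)
      (h.contDiff_velocity.continuous.norm.pow 2)
      fun s hs x hx => by rw [hM s hs x hx, zero_mul]
  · convert! (h.hasDerivAt_integral_speed_sq hc hr hM).add
      ((h.hasDerivAt_selfInteraction hc hr hM).const_mul (1 / (4 * π))) using 1
    field_simp
    ring

/-- The finite energy prevents mass from escaping to, or arriving from, infinity. -/
theorem mass_eq_of_local_support_bound (h : IsEulerPoissonSolution ρ u F) {c d : ℝ} (hc : 0 ≤ c)
    (hcd : c < d)
    (hloc : ∀ c' d', c < c' → d' < d → ∃ M, ∀ s ∈ Icc c' d', ∀ x, M < ‖x‖ → ρ s x = 0) :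
    ∫ x, ρ c x = ∫ x, ρ d x := by
  obtain ⟨e, hce, hed⟩ := exists_between hcd
  set m := ∫ x, ρ e x
  set K := (∫ x, ρ e x * ‖u e x‖ ^ 2) + 1 / (4 * π) * selfInteraction (ρ e)
  have hmass : ∀ s ∈ Ioo c d, ∫ x, ρ s x = m := fun s hs => by
    obtain ⟨M, hM⟩ := hloc (min s e) (max s e) (lt_min hs.1 hce) (max_lt hs.2 hed)
    exact h.mass_eq_of_support_bound (hc.trans (le_min hs.1.le hce.le)) hM
      ⟨min_le_left _ _, le_max_left _ _⟩ ⟨min_le_right _ _, le_max_right _ _⟩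
  have hkin : ∀ s ∈ Ioo c d, ∫ x, ρ s x * ‖u s x‖ ^ 2 ≤ K := fun s hs => by
    obtain ⟨M, hM⟩ := hloc (min s e) (max s e) (lt_min hs.1 hce) (max_lt hs.2 hed)
    have h1 := h.energy_eq_of_support_bound (hc.trans (le_min hs.1.le hce.le)) hM
      (s := s) (t := e)
      ⟨min_le_left _ _, le_max_left _ _⟩ ⟨min_le_right _ _, le_max_right _ _⟩
    have h2 : 0 ≤ 1 / (4 * π) * selfInteraction (ρ s) :=
      mul_nonneg (by positivity) (selfInteraction_nonneg (h.density_nonneg s))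
    linarith
  let β : ContDiffBump (0 : 𝔼) := ⟨1, 2, one_pos, one_lt_two⟩
  have hβ : ContDiff ℝ 1 β := β.contDiff
  obtain ⟨C, hC⟩ := (hβ.continuous_fderiv one_ne_zero).bounded_above_of_compact_support
    (β.hasCompactSupport.fderiv ℝ)
  have hC0 : 0 ≤ C := (norm_nonneg _).trans (hC 0)
  obtain ⟨Mc, hMc0, hMc⟩ := exists_norm_bound_of_hasCompactSupport (h.hasCompactSupport_density c)
  obtain ⟨Md, hMd0, hMd⟩ := exists_norm_bound_of_hasCompactSupport (h.hasCompactSupport_density d)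
  have hψ : ∀ L : ℝ, ContDiff ℝ 1 fun x : 𝔼 => β (L⁻¹ • x) := fun L =>
    hβ.comp (contDiff_const_smul _)
  have hbound : ∀ L, 0 < L → Mc ≤ L → Md ≤ L →
      |(∫ x, ρ d x) - ∫ x, ρ c x| ≤ C * (m + K) * (d - c) * L⁻¹ := by
    intro L hL hLc hLd
    have hsup : ∀ s ∈ Icc c d, ∀ x, 2 * L < ‖x‖ → ρ s x * β (L⁻¹ • x) = 0 := fun s _ x hx => by
      have : β (L⁻¹ • x) = 0 := by
        refine β.zero_of_le_dist ?_
        rw [dist_zero_right, norm_smul, norm_inv, Real.norm_of_nonneg hL.le, ← div_eq_inv_mul,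
          le_div_iff₀ hL]
        exact hx.le
      rw [this, mul_zero]
    have hend : ∀ s M, (∀ x, M < ‖x‖ → ρ s x = 0) → M ≤ L →
        ∫ x, ρ s x * β (L⁻¹ • x) = ∫ x, ρ s x := fun s M hM hML => by
      congr 1 with x
      by_cases hx : M < ‖x‖
      · simp [hM x hx]
      · have : β (L⁻¹ • x) = 1 := by
          refine β.one_of_mem_closedBall ?_
          rw [Metric.mem_closedBall, dist_zero_right, norm_smul, norm_inv,
            Real.norm_of_nonneg hL.le, ← div_eq_inv_mul, div_le_one hL]
          linarith
        rw [this, mul_one]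
    have hcont := h.continuousOn_integral_density_mul (ψ := fun _ x => β (L⁻¹ • x))
      ((hψ L).continuous.comp continuous_snd) hsup
    have hder := fun t ht => h.hasDerivAt_integral_density_mul (ψ := fun _ x => β (L⁻¹ • x))
      (t := t) ((hψ L).comp contDiff_snd) hc ht hsup
    obtain ⟨z, hz, hslope⟩ := exists_hasDerivAt_eq_slope _ _ hcd hcont hder
    have hval : |∫ x, ρ z x * (deriv (fun _ => β (L⁻¹ • x)) z
        + fderiv ℝ (fun x => β (L⁻¹ • x)) x (u z x))| ≤ C * L⁻¹ * (m + K) := by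
      have hk := h.integrable_density_mul z (φ := fun x => ‖u z x‖ ^ 2)
        ((h.continuous_velocity z).norm.pow 2)
      have hI := ((h.integrable_density z).add hk).const_mul (C * L⁻¹)
      rw [← Real.norm_eq_abs]
      refine (norm_integral_le_of_norm_le hI (Eventually.of_forall fun x => ?_)).trans ?_
      · have hscale : HasFDerivAt (fun x : 𝔼 => L⁻¹ • x) (L⁻¹ • ContinuousLinearMap.id ℝ 𝔼) x :=
          (L⁻¹ • ContinuousLinearMap.id ℝ 𝔼).hasFDerivAt
        have hf : HasFDerivAt (fun x : 𝔼 => β (L⁻¹ • x))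
            ((fderiv ℝ (β : 𝔼 → ℝ) (L⁻¹ • x)).comp (L⁻¹ • ContinuousLinearMap.id ℝ 𝔼)) x :=
          ((hβ.differentiable one_ne_zero) (L⁻¹ • x)).hasFDerivAt.comp x hscale
        have h1 : ‖fderiv ℝ (fun x => β (L⁻¹ • x)) x (u z x)‖ ≤ C * L⁻¹ * (1 + ‖u z x‖ ^ 2) := by
          rw [hf.fderiv]
          simp only [ContinuousLinearMap.comp_apply, _root_.smul_apply,
            ContinuousLinearMap.id_apply, map_smul, norm_smul, norm_inv, Real.norm_of_nonneg hL.le]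
          have h2 : ‖fderiv ℝ β (L⁻¹ • x) (u z x)‖ ≤ C * (1 + ‖u z x‖ ^ 2) := by
            refine (ContinuousLinearMap.le_opNorm _ _).trans ?_
            refine mul_le_mul (hC _) ?_ (norm_nonneg _) hC0
            nlinarith [sq_nonneg (‖u z x‖ - 1)]
          calc L⁻¹ * ‖fderiv ℝ β (L⁻¹ • x) (u z x)‖ ≤ L⁻¹ * (C * (1 + ‖u z x‖ ^ 2)) := by gcongr
            _ = _ := by ring
        rw [deriv_const, zero_add, norm_mul, Real.norm_of_nonneg (h.density_nonneg z x)]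
        refine (mul_le_mul_of_nonneg_left h1 (h.density_nonneg z x)).trans_eq ?_
        simp only [Pi.add_apply]
        ring
      · have e : ∫ x, C * L⁻¹ * (ρ z + fun x => ρ z x * ‖u z x‖ ^ 2) x
            = C * L⁻¹ * (m + ∫ x, ρ z x * ‖u z x‖ ^ 2) := by
          rw [integral_const_mul, integral_add' (h.integrable_density z) hk, hmass z hz]
        rw [e]
        have := hkin z hz
        gcongr
    have hdc : 0 < d - c := sub_pos.2 hcd
    rw [hslope, abs_div, abs_of_pos hdc, div_le_iff₀ hdc, hend d Md hMd hLd,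
      hend c Mc hMc hLc] at hval
    refine hval.trans_eq ?_
    ring
  have hlim : Tendsto (fun L : ℝ => C * (m + K) * (d - c) * L⁻¹) atTop (𝓝 0) := by
    simpa using tendsto_inv_atTop_zero.const_mul (C * (m + K) * (d - c))
  have hle : |(∫ x, ρ d x) - ∫ x, ρ c x| ≤ 0 := by
    refine ge_of_tendsto hlim ?_
    filter_upwards [eventually_gt_atTop 0, eventually_ge_atTop Mc, eventually_ge_atTop Md]
      with L h1 h2 h3 using hbound L h1 h2 h3
  linarith [abs_nonpos_iff.1 hle]

/-- A quantitative bound on the propagation of supports when no mass comes in from infinity. -/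
theorem exists_support_bound_of_mass_le (h : IsEulerPoissonSolution ρ u F) (T : ℝ) {n : ℝ}
    (hn : 0 ≤ n) :
    ∃ δ > 0, ∀ a ∈ Icc 0 T, ∀ s ∈ Icc 0 T, |s - a| ≤ δ → (∀ x, n < ‖x‖ → ρ a x = 0) →
      ∫ x, ρ s x ≤ ∫ x, ρ a x → ∀ x, n + 2 < ‖x‖ → ρ s x = 0 := by
  obtain ⟨V, hV⟩ := (isCompact_Icc (a := 0) (b := T)).prod (isCompact_closedBall (0 : 𝔼) (n + 2))
    |>.exists_bound_of_continuousOn h.contDiff_velocity.continuous.continuousOn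
  set W := 2 * (n + 2) * |V| + 1 with hW
  have hWpos : 0 < W := by positivity
  refine ⟨W⁻¹, by positivity, fun a ha s hs hsa hsupp hmass x hx => ?_⟩
  rcases eq_or_ne a s with rfl | hne
  · exact hsupp x (by linarith)
  obtain ⟨σ, hσ, hσpos⟩ : ∃ σ : ℝ, σ * σ = 1 ∧ σ * (s - a) = |s - a| := by
    rcases le_total 0 (s - a) with h0 | h0
    · exact ⟨1, by norm_num, by rw [abs_of_nonneg h0, one_mul]⟩
    · exact ⟨-1, by norm_num, by rw [abs_of_nonpos h0]; ring⟩
  set φ : ℝ → 𝔼 → ℝ := fun r x =>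
    Real.smoothTransition (n ^ 2 + 1 - ‖x‖ ^ 2 + W * (σ * (r - a))) with hφ_def
  have hφ : ContDiff ℝ 1 fun p : ℝ × 𝔼 => φ p.1 p.2 := by
    refine Real.smoothTransition.contDiff.comp ?_
    have : ContDiff ℝ 1 fun p : ℝ × 𝔼 => ‖p.2‖ ^ 2 := contDiff_snd.norm_sq ℝ
    fun_prop
  set lo := min a s
  set hi := max a s
  have hlohi : lo < hi := min_lt_max.2 hne
  have hlo0 : 0 ≤ lo := le_min ha.1 hs.1
  have hhiT : hi ≤ T := max_le ha.2 hs.2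
  have hWr : ∀ r ∈ Icc lo hi, W * (σ * (r - a)) ≤ 1 := by
    intro r hr
    have h1 : |r - a| ≤ |s - a| := by
      rcases le_total a s with h0 | h0
      · rw [show lo = a from min_eq_left h0, show hi = s from max_eq_right h0] at hr
        rw [abs_of_nonneg (by linarith [hr.1]), abs_of_nonneg (by linarith)]
        linarith [hr.2]
      · rw [show lo = s from min_eq_right h0, show hi = a from max_eq_left h0] at hr
        rw [abs_of_nonpos (by linarith [hr.2]), abs_of_nonpos (by linarith)]
        linarith [hr.1]
    have h2 : |σ| = 1 := by
      have : |σ| * |σ| = 1 := by rw [← abs_mul, hσ, abs_one]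
      nlinarith [abs_nonneg σ]
    have h3 : σ * (r - a) ≤ W⁻¹ := by
      refine (le_abs_self _).trans ?_
      rw [abs_mul, h2, one_mul]
      exact h1.trans hsa
    calc W * (σ * (r - a)) ≤ W * W⁻¹ := by gcongr
      _ = 1 := mul_inv_cancel₀ hWpos.ne'
  have hφ0 : ∀ r ∈ Icc lo hi, ∀ x, n + 2 < ‖x‖ → φ r x = 0 := fun r hr x hx => by
    refine Real.smoothTransition.zero_of_nonpos ?_
    have := hWr r hr
    nlinarith [norm_nonneg x]
  have hsup : ∀ r ∈ Icc lo hi, ∀ x, n + 2 < ‖x‖ → ρ r x * φ r x = 0 := fun r hr x hx => by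
    rw [hφ0 r hr x hx, mul_zero]
  have hcont := h.continuousOn_integral_density_mul hφ.continuous hsup
  have hder := fun t ht => h.hasDerivAt_integral_density_mul (t := t) hφ hlo0 ht hsup
  have hθ : ∀ y, HasDerivAt Real.smoothTransition (deriv Real.smoothTransition y) y := fun y =>
    ((Real.smoothTransition.contDiff (n := 1)).differentiable (by simp) y).hasDerivAt
  have hsign : ∀ r ∈ Ioo lo hi, 0 ≤ σ * ∫ x, ρ r x *
      (deriv (fun s => φ s x) r + fderiv ℝ (φ r) x (u r x)) := by
    intro r hr
    rw [← integral_const_mul]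
    refine integral_nonneg fun x => ?_
    have hr' := Ioo_subset_Icc_self hr
    have d1 : HasDerivAt (fun s => φ s x)
        (deriv Real.smoothTransition (n ^ 2 + 1 - ‖x‖ ^ 2 + W * (σ * (r - a))) * (W * σ)) r := by
      have : HasDerivAt (fun r => n ^ 2 + 1 - ‖x‖ ^ 2 + W * (σ * (r - a))) (W * σ) r := by
        simpa using ((((hasDerivAt_id r).sub_const a).const_mul σ).const_mul W).const_add
          (n ^ 2 + 1 - ‖x‖ ^ 2)
      exact (hθ _).comp r this
    have d2 : fderiv ℝ (φ r) x (u r x) =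
        deriv Real.smoothTransition (n ^ 2 + 1 - ‖x‖ ^ 2 + W * (σ * (r - a)))
          * (-(2 * inner ℝ x (u r x))) := by
      have h1 : HasFDerivAt (fun x : 𝔼 => n ^ 2 + 1 - ‖x‖ ^ 2 + W * (σ * (r - a)))
          (-(2 • innerSL ℝ x)) x :=
        ((hasStrictFDerivAt_norm_sq x).hasFDerivAt.const_sub (n ^ 2 + 1)).add_const _
      have h2 : HasFDerivAt (φ r)
          (deriv Real.smoothTransition (n ^ 2 + 1 - ‖x‖ ^ 2 + W * (σ * (r - a)))
            • (-(2 • innerSL ℝ x) : 𝔼 →L[ℝ] ℝ)) x := (hθ _).comp_hasFDerivAt x h1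
      rw [h2.fderiv]
      simp
    rw [d1.deriv, d2]
    have hmono : 0 ≤ deriv Real.smoothTransition
        (n ^ 2 + 1 - ‖x‖ ^ 2 + W * (σ * (r - a))) :=
      Real.smoothTransition.monotone.deriv_nonneg
    rcases lt_or_ge (n + 2) ‖x‖ with hx | hx
    · have hneg : n ^ 2 + 1 - ‖x‖ ^ 2 + W * (σ * (r - a)) < 0 := by
        have := hWr r hr'
        nlinarith [norm_nonneg x]
      have : Real.smoothTransition =ᶠ[𝓝 (n ^ 2 + 1 - ‖x‖ ^ 2 + W * (σ * (r - a)))]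
          fun _ => 0 := by
        filter_upwards [Iio_mem_nhds hneg] with y hy
        exact Real.smoothTransition.zero_of_nonpos (le_of_lt hy)
      rw [this.deriv_eq]
      simp
    · have hu : ‖u r x‖ ≤ |V| := (hV (r, x)
        ⟨⟨hlo0.trans hr'.1, hr'.2.trans hhiT⟩, by simpa using hx⟩).trans (le_abs_self V)
      have hin : |inner ℝ x (u r x)| ≤ (n + 2) * |V| :=
        (abs_real_inner_le_norm _ _).trans (by gcongr)
      have h2 : |σ| = 1 := by
        have : |σ| * |σ| = 1 := by rw [← abs_mul, hσ, abs_one]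
        nlinarith [abs_nonneg σ]
      have h3 : σ * inner ℝ x (u r x) ≤ (n + 2) * |V| := by
        refine (le_abs_self _).trans ?_
        rwa [abs_mul, h2, one_mul]
      have h4 : 0 ≤ W - 2 * (σ * inner ℝ x (u r x)) := by rw [hW]; linarith
      have h5 := mul_nonneg (mul_nonneg (h.density_nonneg r x) hmono) h4
      refine h5.trans_eq ?_
      linear_combination (-(ρ r x * deriv Real.smoothTransition
        (n ^ 2 + 1 - ‖x‖ ^ 2 + W * (σ * (r - a))) * W)) * hσ
  have hgrow : ∫ x, ρ a x * φ a x ≤ ∫ x, ρ s x * φ s x := by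
    obtain ⟨z, hz, hslope⟩ := exists_hasDerivAt_eq_slope _ _ hlohi hcont hder
    have h1 := hsign z hz
    rw [hslope] at h1
    rcases le_total a s with h0 | h0
    · rw [show lo = a from min_eq_left h0, show hi = s from max_eq_right h0] at h1 hlohi
      have h2 : 0 < s - a := by linarith
      have h3 : σ = 1 := by
        rw [abs_of_pos h2] at hσpos
        exact mul_right_cancel₀ h2.ne' (by rw [hσpos, one_mul])
      rw [h3, one_mul, le_div_iff₀ h2] at h1
      linarith
    · rw [show lo = s from min_eq_right h0, show hi = a from max_eq_left h0] at h1 hlohi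
      have h2 : s - a < 0 := by linarith
      have h3 : σ = -1 := by
        rw [abs_of_neg h2] at hσpos
        exact mul_right_cancel₀ h2.ne (by rw [hσpos]; ring)
      rw [h3, neg_one_mul, ← neg_div, le_div_iff₀ (by linarith)] at h1
      linarith
  have hstart : ∫ x, ρ a x * φ a x = ∫ x, ρ a x := by
    congr 1 with y
    by_cases hy : n < ‖y‖
    · simp [hsupp y hy]
    · have : φ a y = 1 := by
        refine Real.smoothTransition.one_of_one_le ?_
        simp only [sub_self, mul_zero, add_zero]
        nlinarith [norm_nonneg y]
      rw [this, mul_one]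
  have hφs : Continuous (φ s) := (contDiff_slice hφ s).continuous
  have hrest_nonneg : ∀ y, 0 ≤ ρ s y * (1 - φ s y) := fun y =>
    mul_nonneg (h.density_nonneg s y) (sub_nonneg.2 (Real.smoothTransition.le_one _))
  have hrest : ∫ y, ρ s y * (1 - φ s y) ≤ 0 := by
    have e : ∀ y, ρ s y * (1 - φ s y) = ρ s y - ρ s y * φ s y := fun y => by ring
    simp_rw [e]
    rw [integral_sub (h.integrable_density s) (h.integrable_density_mul s hφs)]
    linarith
  have hcr : Continuous fun y => ρ s y * (1 - φ s y) :=
    (h.continuous_density s).mul (continuous_const.sub hφs)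
  have hzero : ρ s x * (1 - φ s x) = 0 := by
    by_contra hne0
    have := hcr.integral_pos_of_hasCompactSupport_nonneg_nonzero (μ := volume)
      (h.hasCompactSupport_density s).mul_right hrest_nonneg (x := x) hne0
    linarith
  rw [hφ0 s ⟨min_le_right _ _, le_max_right _ _⟩ x hx] at hzero
  simpa using hzero

/-- Supports are uniformly bounded on bounded time intervals. -/
theorem exists_support_bound (h : IsEulerPoissonSolution ρ u F) (T : ℝ) :
    ∃ M, ∀ s ∈ Icc 0 T, ∀ x, M < ‖x‖ → ρ s x = 0 := by
  let Good : ℝ → Prop := fun t =>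
    ∃ δ > 0, ∃ M, ∀ s, 0 ≤ s → |s - t| < δ → ∀ x, M < ‖x‖ → ρ s x = 0
  suffices hall : ∀ t, 0 ≤ t → Good t from
    exists_support_bound_of_locally le_rfl fun t ht => hall t ht.1
  let B : Set ℝ := Ici 0 ∩ {t | ¬ Good t}
  have hopen : IsOpen {t | Good t} := by
    rw [Metric.isOpen_iff]
    rintro t ⟨δ, hδ, M, hM⟩
    refine ⟨δ / 2, half_pos hδ, fun r hr => ⟨δ / 2, half_pos hδ, M, fun s hs hsr => hM s hs ?_⟩⟩
    have hr' : |r - t| < δ / 2 := by simpa [Real.dist_eq] using hr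
    calc |s - t| ≤ |s - r| + |r - t| := abs_sub_le _ _ _
      _ < δ := by linarith
  have hBclosed : IsClosed B := isClosed_Ici.inter hopen.isClosed_compl
  by_contra hcon
  push Not at hcon
  obtain ⟨t₁, ht₁, hbad₁⟩ := hcon
  have : CompleteSpace B := hBclosed.completeSpace_coe
  have : Nonempty B := ⟨⟨t₁, ht₁, hbad₁⟩⟩
  let f : ℕ → Set B := fun n => {t | ∀ x, (n : ℝ) < ‖x‖ → ρ t x = 0}
  have hfc : ∀ n, IsClosed (f n) := fun n => by
    have : f n = ⋂ x : 𝔼, ⋂ _ : (n : ℝ) < ‖x‖, {t : B | ρ t x = 0} := by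
      ext t
      simp [f]
    rw [this]
    refine isClosed_iInter fun x => isClosed_iInter fun _ => isClosed_eq ?_ continuous_const
    exact h.contDiff_density.continuous.comp
      (Continuous.prodMk continuous_subtype_val continuous_const)
  have hfU : ⋃ n, f n = univ := eq_univ_of_forall fun t => by
    obtain ⟨M, _, hM⟩ := exists_norm_bound_of_hasCompactSupport (h.hasCompactSupport_density t)
    obtain ⟨n, hn⟩ := exists_nat_ge M
    exact mem_iUnion.2 ⟨n, fun x hx => hM x (hn.trans_lt hx)⟩
  obtain ⟨n, ⟨t₀, ht₀B⟩, ht₀⟩ := nonempty_interior_of_iUnion_of_closed hfc hfU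
  obtain ⟨ε, hε, hεf⟩ := Metric.mem_nhds_iff.1 (mem_interior_iff_mem_nhds.1 ht₀)
  have hBn : ∀ t ∈ B, |t - t₀| < ε → ∀ x, (n : ℝ) < ‖x‖ → ρ t x = 0 := fun t ht hd =>
    hεf (show (⟨t, ht⟩ : B) ∈ _ by
      rw [Metric.mem_ball, Subtype.dist_eq, Real.dist_eq]
      exact hd)
  obtain ⟨δ, hδ, hprop⟩ := h.exists_support_bound_of_mass_le (t₀ + 1) (n := n) (Nat.cast_nonneg n)
  have hmass : ∀ c d, 0 ≤ c → c < d → (∀ r ∈ Ioo c d, r ∉ B) → ∫ x, ρ c x = ∫ x, ρ d x :=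
    fun c d hc hcd hgood => h.mass_eq_of_local_support_bound hc hcd fun c' d' hc' hd' =>
      exists_support_bound_of_locally (hc.trans hc'.le) fun t ht => by
        by_contra hb
        exact hgood t ⟨hc'.trans_le ht.1, ht.2.trans_lt hd'⟩
          ⟨hc.trans (hc'.le.trans ht.1), hb⟩
  refine ht₀B.2 ⟨min ε (min δ 1), lt_min hε (lt_min hδ one_pos), n + 2, fun s hs hst => ?_⟩
  obtain ⟨h1, h2, h3⟩ : |s - t₀| < ε ∧ |s - t₀| < δ ∧ |s - t₀| < 1 := by simpa using hst
  have ht₀0 : 0 ≤ t₀ := ht₀B.1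
  by_cases hsB : s ∈ B
  · exact fun x hx => hBn s hsB h1 x (by linarith)
  have hne : s ≠ t₀ := fun e => hsB (e ▸ ht₀B)
  rcases lt_or_gt_of_ne hne with hlt | hlt
  · rw [abs_of_neg (by linarith)] at h1 h2 h3
    have hcomp : IsCompact (B ∩ Icc s t₀) := isCompact_Icc.inter_left hBclosed
    have hmem := hcomp.sInf_mem ⟨t₀, ht₀B, hlt.le, le_rfl⟩
    set a := sInf (B ∩ Icc s t₀)
    have hsa : s < a := lt_of_le_of_ne hmem.2.1 fun e => hsB (e ▸ hmem.1)
    have hm := hmass s a hs hsa fun r hr hrB => by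
      have := csInf_le hcomp.bddBelow (show r ∈ B ∩ Icc s t₀ from
        ⟨hrB, hr.1.le, hr.2.le.trans hmem.2.2⟩)
      exact absurd hr.2 (not_lt.2 this)
    have hat := hmem.2.2
    refine hprop a ⟨hmem.1.1, by linarith⟩ s ⟨hs, by linarith⟩ ?_ (hBn a hmem.1 ?_) hm.le
    · rw [abs_of_neg (by linarith)]
      linarith
    · rw [abs_of_nonpos (by linarith)]
      linarith
  · rw [abs_of_pos (by linarith)] at h1 h2 h3
    have hcomp : IsCompact (B ∩ Icc t₀ s) := isCompact_Icc.inter_left hBclosed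
    have hmem := hcomp.sSup_mem ⟨t₀, ht₀B, le_rfl, hlt.le⟩
    set a := sSup (B ∩ Icc t₀ s)
    have hsa : a < s := lt_of_le_of_ne hmem.2.2 fun e => hsB (e ▸ hmem.1)
    have hm := hmass a s hmem.1.1 hsa fun r hr hrB => by
      have := le_csSup hcomp.bddAbove (show r ∈ B ∩ Icc t₀ s from
        ⟨hrB, hmem.2.1.trans hr.1.le, hr.2.le⟩)
      exact absurd hr.1 (not_lt.2 this)
    have hat := hmem.2.1
    refine hprop a ⟨hmem.1.1, by linarith⟩ s ⟨hs, by linarith⟩ ?_ (hBn a hmem.1 ?_) hm.ge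
    · rw [abs_of_pos (by linarith)]
      linarith
    · rw [abs_of_nonneg (by linarith)]
      linarith

end IsEulerPoissonSolution

namespace IsEulerPoissonSolution

variable {ρ : ℝ → EuclideanSpace ℝ (Fin 3) → ℝ}
  {u F : ℝ → EuclideanSpace ℝ (Fin 3) → EuclideanSpace ℝ (Fin 3)}

theorem integral_norm_sub_smul_sq (h : IsEulerPoissonSolution ρ u F) (t k : ℝ) :
    ∫ x, ‖u t x - k • x‖ ^ 2 * ρ t x
      = (∫ x, ρ t x * ‖u t x‖ ^ 2) - 2 * k * (∫ x, ρ t x * inner ℝ (u t x) x)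
        + k ^ 2 * ∫ x, ρ t x * ‖x‖ ^ 2 := by
  have I1 := h.integrable_density_mul t (φ := fun x => ‖u t x‖ ^ 2)
    ((h.continuous_velocity t).norm.pow 2)
  have I2 := (h.integrable_density_mul t (φ := fun x => inner ℝ (u t x) x)
    ((h.continuous_velocity t).inner continuous_id)).const_mul (2 * k)
  have I3 := (h.integrable_density_mul t (φ := fun x => ‖x‖ ^ 2)
    (continuous_norm.pow 2)).const_mul (k ^ 2)
  rw [← integral_const_mul, ← integral_const_mul, ← integral_sub I1 I2,
    ← integral_add (f := fun x => ρ t x * ‖u t x‖ ^ 2 - 2 * k * (ρ t x * inner ℝ (u t x) x))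
      (I1.sub I2) I3]
  congr 1 with x
  rw [norm_sub_sq_real, inner_smul_right, norm_smul, mul_pow, Real.norm_eq_abs, sq_abs]
  ring

end IsEulerPoissonSolution

/-- The energy of a solution in the coordinates rescaled by `R`. -/
def rescaledEnergy (R : ℝ → ℝ) (ρ : ℝ → 𝔼 → ℝ) (u : ℝ → 𝔼 → 𝔼) (t : ℝ) : ℝ :=
  R t / 2 * (∫ x, ρ t x * ‖u t x‖ ^ 2) - deriv R t * (∫ x, ρ t x * inner ℝ (u t x) x)
    + (deriv R t ^ 2 * (R t)⁻¹ / 2 + (R t ^ 2)⁻¹ / 2) * (∫ x, ρ t x * ‖x‖ ^ 2)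
    + R t * (1 / (8 * π) * selfInteraction (ρ t))

namespace IsEulerPoissonSolution

variable {ρ : ℝ → EuclideanSpace ℝ (Fin 3) → ℝ}
  {u F : ℝ → EuclideanSpace ℝ (Fin 3) → EuclideanSpace ℝ (Fin 3)}

theorem rescaledEnergy_eq (h : IsEulerPoissonSolution ρ u F) {R : ℝ → ℝ} {t : ℝ} (hR : R t ≠ 0) :
    rescaledEnergy R ρ u t = R t / 2 * (∫ x, ‖u t x - (deriv R t / R t) • x‖ ^ 2 * ρ t x)
      + (R t ^ 2)⁻¹ / 2 * (∫ x, ρ t x * ‖x‖ ^ 2)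
      + R t * (1 / (8 * π) * selfInteraction (ρ t)) := by
  rw [rescaledEnergy, h.integral_norm_sub_smul_sq]
  field_simp
  ring

theorem mul_selfInteraction_le_rescaledEnergy (h : IsEulerPoissonSolution ρ u F) {R : ℝ → ℝ} {t : ℝ}
    (hR : 0 < R t) : R t * (1 / (8 * π) * selfInteraction (ρ t)) ≤ rescaledEnergy R ρ u t := by
  rw [h.rescaledEnergy_eq hR.ne']
  have h1 : 0 ≤ ∫ x, ‖u t x - (deriv R t / R t) • x‖ ^ 2 * ρ t x :=
    integral_nonneg fun x => mul_nonneg (sq_nonneg _) (h.density_nonneg t x)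
  have h2 : 0 ≤ ∫ x, ρ t x * ‖x‖ ^ 2 :=
    integral_nonneg fun x => mul_nonneg (h.density_nonneg t x) (sq_nonneg _)
  have h3 : 0 ≤ R t / 2 * (∫ x, ‖u t x - (deriv R t / R t) • x‖ ^ 2 * ρ t x)
      + (R t ^ 2)⁻¹ / 2 * (∫ x, ρ t x * ‖x‖ ^ 2) := by positivity
  linarith

theorem rescaledEnergy_nonneg (h : IsEulerPoissonSolution ρ u F) {R : ℝ → ℝ} {t : ℝ}
    (hR : 0 < R t) : 0 ≤ rescaledEnergy R ρ u t :=
  (mul_nonneg hR.le (mul_nonneg (by positivity)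
    (selfInteraction_nonneg (h.density_nonneg t)))).trans
    (h.mul_selfInteraction_le_rescaledEnergy hR)

theorem hasDerivAt_rescaledEnergy (h : IsEulerPoissonSolution ρ u F) {R : ℝ → ℝ}
    (hR : ContDiff ℝ 2 R) {t : ℝ} (ht : 0 < t) (hRt : 0 < R t)
    (hRode : deriv (deriv R) t = (R t ^ 2)⁻¹) :
    HasDerivAt (rescaledEnergy R ρ u)
      (-(1 / 2) * (deriv R t * ∫ x, ‖u t x - (deriv R t / R t) • x‖ ^ 2 * ρ t x)) t := by
  obtain ⟨M, hM⟩ := h.exists_support_bound (t + 1)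
  have htI : t ∈ Ioo 0 (t + 1) := ⟨ht, lt_add_one t⟩
  have d0 : HasDerivAt R (deriv R t) t := (hR.differentiable two_ne_zero t).hasDerivAt
  have d1 : HasDerivAt (deriv R) (R t ^ 2)⁻¹ t := by
    rw [← hRode]
    exact ((hR.iterate_deriv' 1 1).differentiable one_ne_zero t).hasDerivAt
  have dA := h.hasDerivAt_integral_speed_sq le_rfl htI hM
  have dB := h.hasDerivAt_integral_radial_velocity le_rfl htI hM
  have dI := h.hasDerivAt_integral_norm_sq le_rfl htI hM
  have dP := h.hasDerivAt_selfInteraction le_rfl htI hM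
  rw [h.integral_norm_sub_smul_sq]
  have key := ((((d0.div_const 2).mul dA).sub (d1.mul dB)).add
    (((((d1.pow 2).mul (d0.inv hRt.ne')).div_const 2).add
      (((d0.pow 2).inv (pow_ne_zero 2 hRt.ne')).div_const 2)).mul dI)).add
    (d0.mul (dP.const_mul (1 / (8 * π))))
  refine key.congr_deriv ?_
  simp only [Pi.mul_apply, Pi.pow_apply, Pi.inv_apply, Pi.add_apply]
  field_simp
  ring

theorem continuousOn_rescaledEnergy (h : IsEulerPoissonSolution ρ u F) {R : ℝ → ℝ}
    (hR : ContDiff ℝ 2 R) (hRpos : ∀ t, 0 ≤ t → 0 < R t) (T : ℝ) :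
    ContinuousOn (rescaledEnergy R ρ u) (Icc 0 T) := by
  obtain ⟨M, hM⟩ := h.exists_support_bound T
  have hM' : ∀ ψ : ℝ → 𝔼 → ℝ, ∀ s ∈ Icc 0 T, ∀ x, M < ‖x‖ → ρ s x * ψ s x = 0 :=
    fun ψ s hs x hx => by rw [hM s hs x hx, zero_mul]
  have cu := h.contDiff_velocity.continuous
  have cA := h.continuousOn_integral_density_mul (ψ := fun s x => ‖u s x‖ ^ 2)
    (cu.norm.pow 2) (hM' _)
  have cB := h.continuousOn_integral_density_mul (ψ := fun s x => inner ℝ (u s x) x)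
    (cu.inner continuous_snd) (hM' _)
  have cI := h.continuousOn_integral_density_mul (ψ := fun _ x => ‖x‖ ^ 2)
    (continuous_snd.norm.pow 2) (hM' _)
  have cP := h.continuousOn_selfInteraction hM
  have c0 := hR.continuous.continuousOn (s := Icc 0 T)
  have c1 := (hR.continuous_deriv one_le_two).continuousOn (s := Icc 0 T)
  have hne : ∀ s ∈ Icc 0 T, R s ≠ 0 := fun s hs => (hRpos s hs.1).ne'
  exact ((((c0.div_const 2).mul cA).sub (c1.mul cB)).add
    (((((c1.pow 2).mul (c0.inv₀ hne)).div_const 2).add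
      (((c0.pow 2).inv₀ fun s hs => pow_ne_zero 2 (hne s hs)).div_const 2)).mul cI)).add
    (c0.mul (cP.const_mul (1 / (8 * π))))

end IsEulerPoissonSolution

theorem deriv_nonneg_of_deriv_deriv_nonneg {R : ℝ → ℝ} (hR : ContDiff ℝ 2 R)
    (hR0 : deriv R 0 = 0) (hR2 : ∀ t, 0 ≤ t → 0 ≤ deriv (deriv R) t) {t : ℝ} (ht : 0 ≤ t) :
    0 ≤ deriv R t := by
  have hmono : MonotoneOn (deriv R) (Ici 0) := by
    refine monotoneOn_of_deriv_nonneg (convex_Ici 0)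
      (hR.continuous_deriv one_le_two).continuousOn
      ((hR.iterate_deriv' 1 1).differentiable one_ne_zero).differentiableOn fun s hs => ?_
    exact hR2 s (interior_subset hs)
  exact hR0.symm.trans_le (hmono self_mem_Ici ht ht)

/-- A nonincreasing function bounded below has an integrable derivative. -/
theorem integrableOn_Ici_deriv_of_nonpos_of_nonneg {g g' : ℝ → ℝ} {a : ℝ}
    (hcont : ContinuousOn g (Ici a)) (hderiv : ∀ t ∈ Ioi a, HasDerivAt g (g' t) t)
    (hg' : ∀ t ∈ Ioi a, g' t ≤ 0) (hg : ∀ t ∈ Ici a, 0 ≤ g t) :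
    AntitoneOn g (Ici a) ∧ IntegrableOn g' (Ici a) := by
  have hanti : AntitoneOn g (Ici a) := by
    refine antitoneOn_of_deriv_nonpos (convex_Ici a) hcont ?_ ?_
    · rw [interior_Ici]
      exact fun t ht => (hderiv t ht).differentiableAt.differentiableWithinAt
    · rw [interior_Ici]
      exact fun t ht => (hderiv t ht).deriv.trans_le (hg' t ht)
  have hanti' : Antitone fun t => g (max a t) := fun s t hst =>
    hanti (le_max_left a s) (le_max_left a t) (max_le_max_left a hst)
  have hlim : Tendsto g atTop (𝓝 (⨅ t, g (max a t))) := by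
    refine (tendsto_atTop_ciInf hanti' ⟨0, ?_⟩).congr' ?_
    · rintro _ ⟨t, rfl⟩
      exact hg _ (le_max_left a t)
    · filter_upwards [eventually_ge_atTop a] with t ht
      rw [max_eq_right ht]
  exact ⟨hanti, (integrableOn_Ici_iff_integrableOn_Ioi enorm_ne_top).2
    (integrableOn_Ioi_deriv_of_nonpos (hcont a self_mem_Ici) hderiv hg' hlim)⟩

/-- for a global C¹ solution of the 3-dimensional pressureless
Euler–Poisson system in the plasma case, with `R̈ = R⁻²`, `R(0)=1`, `Ṙ(0)=0`:
`∫_0^∞ Ṙ(s) ∫ |u - (Ṙ/R)x|² ρ dx ds < ∞` and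
`limsup_{t→∞} R(t)^{1/2} ‖∇U(t,·)‖_{L²} < ∞`. -/
theorem stmt7
    (ρ U : ℝ → EuclideanSpace ℝ (Fin 3) → ℝ)
    (u F : ℝ → EuclideanSpace ℝ (Fin 3) → EuclideanSpace ℝ (Fin 3))
    (R : ℝ → ℝ)
    -- potential and self-consistent field: `∇U(t,x) = -(1/4π)∫ (x-y)|x-y|⁻³ ρ(t,y) dy`
    (hU : ∀ t x, U t x = (1 / (4 * π)) * ∫ y, (ρ t y) * ‖x - y‖⁻¹)
    (hF : ∀ t x, F t x = (-(1 / (4 * π))) • ∫ y, (ρ t y * (‖x - y‖ ^ 3)⁻¹) • (x - y))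
    -- the rescaling function: `R̈ = R⁻²`, `R(0)=1`, `Ṙ(0)=0`
    (hR : ContDiff ℝ 2 R) (hR0 : R 0 = 1) (hR'0 : deriv R 0 = 0)
    (hRpos : ∀ t : ℝ, 0 ≤ t → 0 < R t)
    (hRode : ∀ t : ℝ, 0 ≤ t → deriv (deriv R) t = (R t ^ 2)⁻¹)
    -- `(ρ,u)` is a global C¹ solution, `ρ ≥ 0` compactly supported
    (hρ_C1 : ContDiff ℝ 1 (fun p : ℝ × EuclideanSpace ℝ (Fin 3) => ρ p.1 p.2))
    (hu_C1 : ContDiff ℝ 1 (fun p : ℝ × EuclideanSpace ℝ (Fin 3) => u p.1 p.2))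
    (hρ_nonneg : ∀ t x, 0 ≤ ρ t x)
    (hρ_supp : ∀ t : ℝ, HasCompactSupport (fun x => ρ t x))
    -- continuity equation `∂_t ρ + div(ρu) = 0`
    (hcontinuity : ∀ t : ℝ, 0 ≤ t → ∀ x,
      deriv (fun s => ρ s x) t
        + ∑ i : Fin 3, fderiv ℝ (fun y => ρ t y * u t y i) x (EuclideanSpace.single i 1) = 0)
    -- momentum equation `∂_t u + (u·∇)u = −∇U`
    (hmomentum : ∀ t : ℝ, 0 ≤ t → ∀ x,
      deriv (fun s => u s x) t + fderiv ℝ (fun y => u t y) x (u t x) + F t x = 0) :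
    IntegrableOn
      (fun s => deriv R s * ∫ x, ‖u s x - (deriv R s / R s) • x‖ ^ 2 * ρ s x) (Ici 0) ∧
    ∃ C : ℝ, ∀ᶠ t in Filter.atTop,
      Real.sqrt (R t) * Real.sqrt (∫ x, ‖F t x‖ ^ 2) ≤ C := by
  have h : IsEulerPoissonSolution ρ u F :=
    ⟨hF, hρ_C1, hu_C1, hρ_nonneg, hρ_supp, hcontinuity, hmomentum⟩
  have hR' : ∀ t, 0 ≤ t → 0 ≤ deriv R t := fun t ht =>
    deriv_nonneg_of_deriv_deriv_nonneg hR hR'0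
      (fun s hs => by rw [hRode s hs]; positivity) ht
  have hcont : ContinuousOn (rescaledEnergy R ρ u) (Ici 0) := fun t ht =>
    (h.continuousOn_rescaledEnergy hR hRpos (t + 1) t ⟨ht, (lt_add_one t).le⟩).mono_of_mem_nhdsWithin
      (inter_mem self_mem_nhdsWithin (mem_nhdsWithin_of_mem_nhds (Iic_mem_nhds (lt_add_one t))))
  obtain ⟨hanti, hint⟩ := integrableOn_Ici_deriv_of_nonpos_of_nonneg hcont
    (fun t ht => h.hasDerivAt_rescaledEnergy hR ht (hRpos t (le_of_lt ht))
      (hRode t (le_of_lt ht)))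
    (fun t ht => mul_nonpos_of_nonpos_of_nonneg (by norm_num) (mul_nonneg (hR' t (le_of_lt ht))
      (integral_nonneg fun x => mul_nonneg (sq_nonneg _) (hρ_nonneg t x))))
    (fun t ht => h.rescaledEnergy_nonneg (hRpos t ht))
  refine ⟨?_, ?_⟩
  · refine (hint.const_mul (-2)).congr (Eventually.of_forall fun t => ?_)
    ring
  · obtain ⟨C, hC0, hC⟩ := exists_integral_norm_field_sq_le
    refine ⟨√(C * (8 * π * rescaledEnergy R ρ u 0)), ?_⟩
    filter_upwards [eventually_ge_atTop 0] with t ht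
    rw [← Real.sqrt_mul (hRpos t ht).le]
    refine Real.sqrt_le_sqrt ?_
    have h1 := hC (ρ t) (h.continuous_density t) (hρ_supp t) (hρ_nonneg t)
    simp_rw [← hF t] at h1
    have h2 := (h.mul_selfInteraction_le_rescaledEnergy (hRpos t ht)).trans
      (hanti self_mem_Ici ht ht)
    calc R t * ∫ x, ‖F t x‖ ^ 2 ≤ R t * (C * selfInteraction (ρ t)) :=
          mul_le_mul_of_nonneg_left h1 (hRpos t ht).le
      _ = C * (8 * π * (R t * (1 / (8 * π) * selfInteraction (ρ t)))) := by
          field_simp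
      _ ≤ C * (8 * π * rescaledEnergy R ρ u 0) := by gcongr
end
end
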